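/- arXiv:2304.03467 — 8 statements merged into one kernel-verified Lean document; each statement's English description precedes it below -/
import Mathlib

section
/- Let p, t, a1 be nonzero complex numbers and let F1, F2, G1, G2, H2 be nonzero complex numbers (G_i playing the role of the time-evolved F_i at pt, and H2 that of F2 at p^2 t) with t − a1·G2 ≠ 0. Assume: (i) G1 + 1/F1 = a1^{−2}·(F2 + 1/G2); (ii) G2 + 1/F2 = a1·t/(F1·F2); (iii) H2 + 1/G2 = a1·(p·t)/(G1·G2). Then (H2·G2 + 1)·(G2·F2 + 1) = p·a1^3·t^2·G2/(t − a1·G2). -/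
/-- Eliminating `F₁` from the `N = 1` case of the system qP⁽²⁾(A₆⁽¹⁾) yields the
`q`-Painlevé II equation of `A₆⁽¹⁾`-surface type.  Here `G₁, G₂` play the role of the
time-evolved `F₁, F₂` at `p·t`, and `H₂` that of `F₂` at `p²·t`. -/
theorem qPII_from_qP2_A6 (p t a1 F1 F2 G1 G2 H2 : ℂ)
    (hp : p ≠ 0) (ht : t ≠ 0) (ha1 : a1 ≠ 0)
    (hF1 : F1 ≠ 0) (hF2 : F2 ≠ 0) (hG1 : G1 ≠ 0) (hG2 : G2 ≠ 0) (hH2 : H2 ≠ 0)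
    (hden : t - a1 * G2 ≠ 0)
    (h1 : G1 + 1 / F1 = (a1 ^ 2)⁻¹ * (F2 + 1 / G2))
    (h2 : G2 + 1 / F2 = a1 * t / (F1 * F2))
    (h3 : H2 + 1 / G2 = a1 * (p * t) / (G1 * G2)) :
    (H2 * G2 + 1) * (G2 * F2 + 1) = p * a1 ^ 3 * t ^ 2 * G2 / (t - a1 * G2) := by
  have e2 : F1 * (G2 * F2 + 1) = a1 * t := by
    field_simp at h2
    linear_combination h2
  have e3 : G1 * (H2 * G2 + 1) = a1 * (p * t) := by
    field_simp at h3
    linear_combination h3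
  have e1 : a1 ^ 2 * G2 * (G1 * F1 + 1) = F1 * (G2 * F2 + 1) := by
    field_simp at h1
    linear_combination h1
  have e4 : a1 * G2 * (G1 * F1) = t - a1 * G2 := by
    apply mul_left_cancel₀ ha1
    linear_combination e1 + e2
  rw [eq_div_iff hden, ← e4]
  linear_combination a1 * G2 * G1 * (H2 * G2 + 1) * e2 + a1 ^ 2 * t * G2 * e3
end

section
/- Let K be a field, let α1, α2, α3 ∈ K and u, u1, u2, u3 ∈ K be nonzero, and for 1 ≤ i < j ≤ 3 define u_{ij} = u·(α_i·u_i − α_j·u_j)/(α_j·u_i − α_i·u_j), assuming all three denominators α_j·u_i − α_i·u_j are nonzero. Then, assuming additionally that the three quantities α2·u12 − α1·u23(?)-type denominators below are nonzero, the three expressions u1·(α2·u12 − α3·u13)/(α3·u12 − α2·u13), u2·(α1·u12 − α3·u23)/(α3·u12 − α1·u23), and u3·(α1·u13 − α2·u23)/(α2·u13 − α1·u23) are all equal. (Precisely: whenever α3·u12 − α2·u13, α3·u12 − α1·u23 and α2·u13 − α1·u23 are nonzero, the three values coincide.) -/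
/-- Consistency around a cube for the lattice modified KdV equation: with initial data
`u, u₁, u₂, u₃` and face values `u_{ij} = u·(αᵢuᵢ − αⱼuⱼ)/(αⱼuᵢ − αᵢuⱼ)`, the three ways of
computing the value at the opposite vertex of the cube agree. -/
theorem lmKdV_CAC {K : Type*} [Field K] (α1 α2 α3 u u1 u2 u3 : K)
    (hα1 : α1 ≠ 0) (hα2 : α2 ≠ 0) (hα3 : α3 ≠ 0)
    (hu : u ≠ 0) (hu1 : u1 ≠ 0) (hu2 : u2 ≠ 0) (hu3 : u3 ≠ 0)
    (h12 : α2 * u1 - α1 * u2 ≠ 0) (h13 : α3 * u1 - α1 * u3 ≠ 0)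
    (h23 : α3 * u2 - α2 * u3 ≠ 0)
    (u12 u13 u23 : K)
    (hu12 : u12 = u * (α1 * u1 - α2 * u2) / (α2 * u1 - α1 * u2))
    (hu13 : u13 = u * (α1 * u1 - α3 * u3) / (α3 * u1 - α1 * u3))
    (hu23 : u23 = u * (α2 * u2 - α3 * u3) / (α3 * u2 - α2 * u3))
    (hd1 : α3 * u12 - α2 * u13 ≠ 0) (hd2 : α3 * u12 - α1 * u23 ≠ 0)
    (hd3 : α2 * u13 - α1 * u23 ≠ 0) :
    u1 * (α2 * u12 - α3 * u13) / (α3 * u12 - α2 * u13)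
      = u2 * (α1 * u12 - α3 * u23) / (α3 * u12 - α1 * u23) ∧
    u2 * (α1 * u12 - α3 * u23) / (α3 * u12 - α1 * u23)
      = u3 * (α1 * u13 - α2 * u23) / (α2 * u13 - α1 * u23) := by
  rw [div_eq_div_iff hd1 hd2, div_eq_div_iff hd2 hd3]
  subst hu12 hu13 hu23
  clear hd1 hd2 hd3
  generalize hD12 : α2 * u1 - α1 * u2 = D12 at *
  generalize hD13 : α3 * u1 - α1 * u3 = D13 at *
  generalize hD23 : α3 * u2 - α2 * u3 = D23 at *
  constructor <;> field_simp <;> subst hD12 hD13 hD23 <;> ring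
end

section
/- Let K be a field, let α1, α2, κ ∈ K and u, u1, u2, u0 ∈ K be nonzero with α2·u1 − α1·u2 ≠ 0. Define u12 = u·(α1·u1 − α2·u2)/(α2·u1 − α1·u2), u01 = −u·(u0/u1 + α1·κ), and u02 = −u·(u0/u2 + α2·κ). Assume u12, u01, u02 are nonzero and α2·u01 − α1·u02 ≠ 0. Then the three expressions u0·(α1·u01 − α2·u02)/(α2·u01 − α1·u02), −u2·(u02/u12 + α1·κ), and −u1·(u01/u12 + α2·κ) are all equal. -/
/-- Consistency around a cube for the mixed system consisting of the lattice modified KdV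
equation (on the face spanned by the lattice directions `1, 2`) and of Boll's D4 equation
(on the faces involving the extra direction `0`): with initial data `u, u₁, u₂, u₀`, the
three ways of computing the value `u₀₁₂` at the opposite vertex of the cube agree. -/
theorem lmKdV_D4_CAC {K : Type*} [Field K] (α1 α2 κ u u1 u2 u0 : K)
    (hα1 : α1 ≠ 0) (hα2 : α2 ≠ 0) (hκ : κ ≠ 0)
    (hu : u ≠ 0) (hu1 : u1 ≠ 0) (hu2 : u2 ≠ 0) (hu0 : u0 ≠ 0)
    (h12 : α2 * u1 - α1 * u2 ≠ 0)
    (u12 u01 u02 : K)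
    (hu12 : u12 = u * (α1 * u1 - α2 * u2) / (α2 * u1 - α1 * u2))
    (hu01 : u01 = -u * (u0 / u1 + α1 * κ))
    (hu02 : u02 = -u * (u0 / u2 + α2 * κ))
    (hu12' : u12 ≠ 0) (hu01' : u01 ≠ 0) (hu02' : u02 ≠ 0)
    (hd : α2 * u01 - α1 * u02 ≠ 0) :
    u0 * (α1 * u01 - α2 * u02) / (α2 * u01 - α1 * u02)
      = -u2 * (u02 / u12 + α1 * κ) ∧
    -u2 * (u02 / u12 + α1 * κ) = -u1 * (u01 / u12 + α2 * κ) := by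
  have hN : α1 * u1 - α2 * u2 ≠ 0 := by
    intro h
    exact hu12' (by rw [hu12, h, mul_zero, zero_div])
  have hu12_mul : u12 * (α2 * u1 - α1 * u2) = u * (α1 * u1 - α2 * u2) :=
    (eq_div_iff h12).mp hu12
  have hden : α2 * u01 - α1 * u02 = u * u0 * (α1 * u1 - α2 * u2) / (u1 * u2) := by
    rw [hu01, hu02]
    field_simp
    ring
  -- All three expressions equal this rational function of the initial data.
  set w := (u0 * (α2 * u1 - α1 * u2) - κ * (α1 ^ 2 - α2 ^ 2) * u1 * u2) /
    (α1 * u1 - α2 * u2) with hw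
  have h_lattice : u0 * (α1 * u01 - α2 * u02) / (α2 * u01 - α1 * u02) = w := by
    rw [hden, hw, hu01, hu02]
    field_simp
    ring
  have h_side₁ : -u2 * (u02 / u12 + α1 * κ) = w := by
    have hquot : u02 / u12 = -(u0 / u2 + α2 * κ) * (α2 * u1 - α1 * u2) /
        (α1 * u1 - α2 * u2) := by
      rw [div_eq_div_iff hu12' hN]
      linear_combination (α1 * u1 - α2 * u2) * hu02 + (u0 / u2 + α2 * κ) * hu12_mul
    rw [hw, hquot, eq_div_iff hN, mul_assoc, add_mul, div_mul_cancel₀ _ hN]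
    field_simp
    ring
  have h_side₂ : -u1 * (u01 / u12 + α2 * κ) = w := by
    have hquot : u01 / u12 = -(u0 / u1 + α1 * κ) * (α2 * u1 - α1 * u2) /
        (α1 * u1 - α2 * u2) := by
      rw [div_eq_div_iff hu12' hN]
      linear_combination (α1 * u1 - α2 * u2) * hu01 + (u0 / u1 + α1 * κ) * hu12_mul
    rw [hw, hquot, eq_div_iff hN, mul_assoc, add_mul, div_mul_cancel₀ _ hN]
    field_simp
    ring
  exact ⟨h_lattice.trans h_side₁.symm, h_side₁.trans h_side₂.symm⟩
end

section
/- Let λ0 ∈ ℂ be nonzero and define λ: ℤ → ℂ by λ(m) = λ0 if m is even and λ(m) = λ0^{−1} if m is odd. Fix m ∈ ℤ and nonzero H0, H1, H2, H0', H1' ∈ ℂ satisfying H1 = 1/(λ(m)·H0), H2 = 1/(λ(m+1)·H1), H0' = λ(m)^2/H0, H1' = λ(m+1)^2/H1. (a) For all nonzero α_i, α_j, U, U_i, U_j, U_{ij} ∈ ℂ with α_j·U_i − α_i·U_j ≠ 0, setting u = H0·U, u_i = H1·U_i, u_j = H1·U_j, u_{ij} = H2·U_{ij}, the equation λ(m)^2·U_{ij}/U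 = (α_i·U_i − α_j·U_j)/(α_j·U_i − α_i·U_j) holds if and only if u_{ij}/u = (α_i·u_i − α_j·u_j)/(α_j·u_i − α_i·u_j). (b) For all nonzero α_k, κ, U, U_k, U_0, U_{0k} ∈ ℂ, setting u = H0·U, u_k = H1·U_k, u_0 = H0'·U_0, u_{0k} = H1'·U_{0k}, the equation U_{0k}/U + λ(m)^4·U_0/U_k + α_k·κ·λ(m) = 0 holds if and only if u_{0k}/u + u_0/u_k + α_k·κ = 0. -/
theorem alternating_succ {lam0 : ℂ} {lam : ℤ → ℂ}
    (hlam : ∀ m : ℤ, lam m = if Even m then lam0 else lam0⁻¹) (m : ℤ) :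
    lam (m + 1) = (lam m)⁻¹ := by
  by_cases h : Even m <;> simp [hlam, h]

theorem alternating_ne_zero {lam0 : ℂ} (hlam0 : lam0 ≠ 0) {lam : ℤ → ℂ}
    (hlam : ∀ m : ℤ, lam m = if Even m then lam0 else lam0⁻¹) (m : ℤ) :
    lam m ≠ 0 := by
  rw [hlam]
  split_ifs
  exacts [hlam0, inv_ne_zero hlam0]

/-- Gauge equivalence between the paper's lattice system in the `U` variables
(with the alternating parameter `λ`) and the system consisting of the lattice modified KdV
equation and Boll's D4 equation in the variables `u = H·U`.  Here `H0, H1, H2, H0', H1'`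
stand for `H(l,l0), H(l+1,l0), H(l+2,l0), H(l,l0+1), H(l+1,l0+1)` with `m = l + l0`. -/
theorem gauge_equivalence (lam0 : ℂ) (hlam0 : lam0 ≠ 0)
    (lam : ℤ → ℂ) (hlam : ∀ m : ℤ, lam m = if Even m then lam0 else lam0⁻¹)
    (m : ℤ) (H0 H1 H2 H0' H1' : ℂ)
    (hH0 : H0 ≠ 0) (hH1 : H1 ≠ 0) (hH2 : H2 ≠ 0) (hH0' : H0' ≠ 0) (hH1' : H1' ≠ 0)
    (e1 : H1 = 1 / (lam m * H0)) (e2 : H2 = 1 / (lam (m + 1) * H1))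
    (e3 : H0' = lam m ^ 2 / H0) (e4 : H1' = lam (m + 1) ^ 2 / H1) :
    (∀ αi αj U Ui Uj Uij : ℂ, αi ≠ 0 → αj ≠ 0 → U ≠ 0 → Ui ≠ 0 → Uj ≠ 0 → Uij ≠ 0 →
      αj * Ui - αi * Uj ≠ 0 →
      (lam m ^ 2 * Uij / U = (αi * Ui - αj * Uj) / (αj * Ui - αi * Uj) ↔
        (H2 * Uij) / (H0 * U)
          = (αi * (H1 * Ui) - αj * (H1 * Uj)) / (αj * (H1 * Ui) - αi * (H1 * Uj)))) ∧
    (∀ αk κ U Uk U0 U0k : ℂ, αk ≠ 0 → κ ≠ 0 → U ≠ 0 → Uk ≠ 0 → U0 ≠ 0 → U0k ≠ 0 →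
      (U0k / U + lam m ^ 4 * U0 / Uk + αk * κ * lam m = 0 ↔
        (H1' * U0k) / (H0 * U) + (H0' * U0) / (H1 * Uk) + αk * κ = 0)) := by
  have hL := alternating_ne_zero hlam0 hlam m
  rw [alternating_succ hlam] at e2 e4
  generalize lam m = L at *
  have h20 : H2 = L ^ 2 * H0 := by
    rw [e2, e1]
    field_simp
  have h10 : H1' = H0 / L := by
    rw [e4, e1]
    field_simp
  have h01 : H0' = L ^ 3 * H1 := by
    rw [e3, e1]
    field_simp
  refine ⟨fun αi αj U Ui Uj Uij _ _ _ _ _ _ _ => ?_, fun αk κ U Uk U0 U0k _ _ hU hUk _ _ => ?_⟩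
  · have hl : H2 * Uij / (H0 * U) = L ^ 2 * Uij / U := by
      rw [h20, mul_right_comm, mul_comm H0 U, mul_div_mul_right _ _ hH0]
    have hr : (αi * (H1 * Ui) - αj * (H1 * Uj)) / (αj * (H1 * Ui) - αi * (H1 * Uj))
        = (αi * Ui - αj * Uj) / (αj * Ui - αi * Uj) := by
      rw [← mul_div_mul_left _ (αj * Ui - αi * Uj) hH1]
      ring
    rw [hl, hr]
  · have h : U0k / U + L ^ 4 * U0 / Uk + αk * κ * L
        = L * (H1' * U0k / (H0 * U) + H0' * U0 / (H1 * Uk) + αk * κ) := by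
      rw [h10, h01]
      field_simp
    rw [h, mul_eq_zero, or_iff_right hL]
end

section
/- Let K be a field. On 6-tuples v = (a0, a1, b, q, f1, f2) of nonzero elements of K satisfying a0·a1 = q, define the (partially defined) maps: s1(v) = (a0·a1^2, a1^{−1}, b, q, f1·(a1^2·f1·f2 − 1)/(f1·f2 − a1^2), f2·(f1·f2 − a1^2)/(a1^2·f1·f2 − 1)); π(v) = (a1, a0, q·b, q, f2, −(1/f1)·(1 + q·a0·b/f2)); w1(v) = (a0^{−1}, a1^{−1}, q^2·b, q^{−1}, f2, f1); and set s0 = π∘s1∘π^{−1}, w0 = w1∘π∘π, r = w1∘π. Then, at every tuple at which all the rational expressions arising in the indicated composites are defined (all denominators nonzero) and have nonzero entries: s0∘s0 = id, s1∘s1 = id, w0∘w0 = id, w1∘w1 = id, (w0∘s0)∘(w0∘s0) = id, (w0∘s1)∘(w0∘s1) = id, (w1∘s0)∘(w1∘s0) = id, (w1∘s1)∘(w1∘s1) = id, and r∘r = id. -/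
namespace WeylA1A1

/-- A 6-tuple `(a₀, a₁, b, q, f₁, f₂)` of elements of a field `K`. -/
structure Tup (K : Type*) where
  a0 : K
  a1 : K
  b : K
  q : K
  f1 : K
  f2 : K

variable {K : Type*} [Field K]

/-- All entries of the tuple are nonzero. -/
def Nz (v : Tup K) : Prop :=
  v.a0 ≠ 0 ∧ v.a1 ≠ 0 ∧ v.b ≠ 0 ∧ v.q ≠ 0 ∧ v.f1 ≠ 0 ∧ v.f2 ≠ 0

/-- The constraint `a₀·a₁ = q`. -/
def C (v : Tup K) : Prop := v.a0 * v.a1 = v.q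

/-- The map `s₁`. -/
def s1 (v : Tup K) : Tup K :=
  ⟨v.a0 * v.a1 ^ 2, v.a1⁻¹, v.b, v.q,
    v.f1 * (v.a1 ^ 2 * v.f1 * v.f2 - 1) / (v.f1 * v.f2 - v.a1 ^ 2),
    v.f2 * (v.f1 * v.f2 - v.a1 ^ 2) / (v.a1 ^ 2 * v.f1 * v.f2 - 1)⟩

/-- The map `π`. -/
def piMap (v : Tup K) : Tup K :=
  ⟨v.a1, v.a0, v.q * v.b, v.q, v.f2, -(1 / v.f1) * (1 + v.q * v.a0 * v.b / v.f2)⟩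

/-- The (partial, birational) inverse of `π`. -/
def piInv (v : Tup K) : Tup K :=
  ⟨v.a1, v.a0, v.b / v.q, v.q, -(1 + v.a1 * v.b / v.f1) / v.f2, v.f1⟩

/-- The map `w₁`. -/
def w1 (v : Tup K) : Tup K :=
  ⟨v.a0⁻¹, v.a1⁻¹, v.q ^ 2 * v.b, v.q⁻¹, v.f2, v.f1⟩

/-- `s₀ = π ∘ s₁ ∘ π⁻¹`. -/
def s0 (v : Tup K) : Tup K := piMap (s1 (piInv v))

/-- `w₀ = w₁ ∘ π ∘ π`. -/
def w0 (v : Tup K) : Tup K := w1 (piMap (piMap v))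

/-- `r = w₁ ∘ π`. -/
def r (v : Tup K) : Tup K := w1 (piMap v)

/-- Application of a chain of maps (in application order). -/
def apChain : List (Tup K → Tup K) → Tup K → Tup K
  | [], v => v
  | f :: fs, v => apChain fs (f v)

/-- All tuples appearing along a chain of maps have nonzero entries (in particular all
denominators arising in the composite are nonzero). -/
def okChain : List (Tup K → Tup K) → Tup K → Prop
  | [], v => Nz v
  | f :: fs, v => Nz v ∧ okChain fs (f v)

/-- `s₀` as the chain `[π⁻¹, s₁, π]` (in application order). -/
def s0L : List (Tup K → Tup K) := [piInv, s1, piMap]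

/-- `w₀` as the chain `[π, π, w₁]` (in application order). -/
def w0L : List (Tup K → Tup K) := [piMap, piMap, w1]

/-- `r` as the chain `[π, w₁]` (in application order). -/
def rL : List (Tup K → Tup K) := [piMap, w1]

lemma C.s1 {v : Tup K} (hC : C v) (hv : Nz v) : C (s1 v) := by
  obtain ⟨-, h1, -⟩ := hv
  simp only [C, WeylA1A1.s1] at *
  rw [← hC]
  field_simp

lemma C.piMap {v : Tup K} (hC : C v) : C (piMap v) := (mul_comm _ _).trans hC

lemma C.piInv {v : Tup K} (hC : C v) : C (piInv v) := (mul_comm _ _).trans hC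

lemma w1_w1 {v : Tup K} (hv : Nz v) : w1 (w1 v) = v := by
  obtain ⟨a0, a1, b, q, f1, f2⟩ := v
  obtain ⟨-, -, -, hq, -⟩ := hv
  simp only [w1, inv_inv, Tup.mk.injEq, true_and, and_true]
  field_simp

lemma nz_of_nz_w1 {v : Tup K} (h : Nz (w1 v)) : Nz v := by
  obtain ⟨h0, h1, hb, hq, hf1, hf2⟩ := h
  exact ⟨inv_eq_zero.not.mp h0, inv_eq_zero.not.mp h1, right_ne_zero_of_mul hb,
    inv_eq_zero.not.mp hq, hf2, hf1⟩

lemma nz_s1_iff {v : Tup K} (hv : Nz v) :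
    Nz (s1 v) ↔ v.f1 * v.f2 - v.a1 ^ 2 ≠ 0 ∧ v.a1 ^ 2 * v.f1 * v.f2 - 1 ≠ 0 := by
  obtain ⟨h0, h1, hb, hq, hf1, hf2⟩ := hv
  simp [Nz, s1, h0, h1, hb, hq, hf1, hf2]
  tauto

lemma s1_f1_mul_s1_f2 {v : Tup K} (hv : Nz v) (hs : Nz (s1 v)) :
    (s1 v).f1 * (s1 v).f2 = v.f1 * v.f2 := by
  obtain ⟨h1, h2⟩ := (nz_s1_iff hv).mp hs
  simp only [s1]
  rw [div_mul_div_comm, div_eq_iff (mul_ne_zero h1 h2)]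
  ring

lemma s1_s1 {v : Tup K} (hv : Nz v) (hs : Nz (s1 v)) : s1 (s1 v) = v := by
  have hprod := s1_f1_mul_s1_f2 hv hs
  rw [nz_s1_iff hv] at hs
  obtain ⟨a0, a1, b, q, f1, f2⟩ := v
  obtain ⟨-, h1, -, -, hf1, hf2⟩ := hv
  obtain ⟨hs1, hs2⟩ := hs
  simp only [s1] at *
  have hnum : a1⁻¹ ^ 2 * (f1 * f2) - 1 = (f1 * f2 - a1 ^ 2) / a1 ^ 2 := by field_simp
  have hden : f1 * f2 - a1⁻¹ ^ 2 = (a1 ^ 2 * f1 * f2 - 1) / a1 ^ 2 := by field_simp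
  simp only [mul_assoc (a1⁻¹ ^ 2), hprod, hnum, hden, inv_inv, Tup.mk.injEq, true_and]
  generalize f1 * f2 - a1 ^ 2 = D at *
  generalize a1 ^ 2 * f1 * f2 - 1 = E at *
  refine ⟨?_, ?_, ?_⟩ <;> field_simp

lemma piInv_piMap {v : Tup K} (hv : Nz v) (hp : Nz (piMap v)) : piInv (piMap v) = v := by
  obtain ⟨a0, a1, b, q, f1, f2⟩ := v
  obtain ⟨-, -, -, hq, hf1, hf2⟩ := hv
  obtain ⟨-, -, -, -, -, hp⟩ := hp
  simp only [piMap] at hp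
  simp only [piInv, piMap, Tup.mk.injEq, true_and, and_true]
  refine ⟨by field_simp, ?_⟩
  rw [div_eq_iff hp]
  field_simp

lemma piMap_piInv {v : Tup K} (hv : Nz v) (hp : Nz (piInv v)) : piMap (piInv v) = v := by
  obtain ⟨a0, a1, b, q, f1, f2⟩ := v
  obtain ⟨-, -, -, hq, hf1, hf2⟩ := hv
  obtain ⟨-, -, -, -, hp, -⟩ := hp
  simp only [piInv] at hp
  simp only [piInv, piMap, Tup.mk.injEq, true_and]
  refine ⟨by field_simp, ?_⟩
  rw [neg_mul, neg_eq_iff_eq_neg, one_div, inv_mul_eq_iff_eq_mul₀ hp]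
  field_simp

lemma piInv_w1 {v : Tup K} (hC : C v) (hv : Nz v) : piInv (w1 v) = w1 (piMap v) := by
  obtain ⟨a0, a1, b, q, f1, f2⟩ := v
  obtain ⟨-, h1, -, hq, hf1, hf2⟩ := hv
  simp only [C] at hC h1
  subst hC
  simp only [piInv, piMap, w1, Tup.mk.injEq, true_and, and_true]
  constructor <;> field_simp

lemma piMap_w1_piMap {v : Tup K} (hC : C v) (hv : Nz v) (hp : Nz (piMap v)) :
    piMap (w1 (piMap v)) = w1 v := by
  obtain ⟨a0, a1, b, q, f1, f2⟩ := v
  obtain ⟨-, h1, -, hq, hf1, hf2⟩ := hv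
  obtain ⟨-, -, -, -, -, hp⟩ := hp
  simp only [C] at hC h1
  subst hC
  simp only [piMap] at hp
  simp only [piMap, w1, Tup.mk.injEq, true_and]
  refine ⟨by field_simp, ?_⟩
  rw [neg_mul, neg_eq_iff_eq_neg, one_div, inv_mul_eq_iff_eq_mul₀ hp]
  field_simp

lemma s1_w1 {v : Tup K} (hv : Nz v) : s1 (w1 v) = w1 (s1 v) := by
  obtain ⟨a0, a1, b, q, f1, f2⟩ := v
  obtain ⟨-, h1, -⟩ := hv
  have h2 : a1 ^ 2 ≠ 0 := pow_ne_zero 2 h1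
  simp only [s1, w1, Tup.mk.injEq, true_and]
  refine ⟨by field_simp, ?_, ?_⟩
  · rw [← mul_div_mul_left _ _ h2]
    congr 1 <;> field_simp
  · rw [← mul_div_mul_left _ _ h2]
    congr 1 <;> field_simp

/-- The factor `f₁f₂ - a₁²` in `s₁` evaluated at `π (π v)`. -/
lemma piMap_piMap_f1_mul_f2_sub {v : Tup K} (hC : C v) (hv : Nz v) (hp : Nz (piMap v)) :
    (piMap (piMap v)).f1 * (piMap (piMap v)).f2 - (piMap (piMap v)).a1 ^ 2 =
      (v.a1 ^ 2 * v.f1 * v.f2 - 1) * ((piMap v).f2 / v.f2) := by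
  obtain ⟨a0, a1, b, q, f1, f2⟩ := v
  obtain ⟨-, -, -, -, hf1, hf2⟩ := hv
  obtain ⟨-, -, -, -, -, hp⟩ := hp
  simp only [C] at hC
  subst hC
  simp only [piMap] at *
  set g := -(1 / f1) * (1 + a0 * a1 * a0 * b / f2) with hg
  have hg' : f1 * f2 * g = -(f2 + a0 * a1 * a0 * b) := by rw [hg]; field_simp
  field_simp
  linear_combination (-1) * a1 ^ 2 * hg'

lemma nz_s1_piMap_piMap {v : Tup K} (hC : C v) (hv : Nz v) (hs : Nz (s1 v))
    (hp : Nz (piMap v)) (hpp : Nz (piMap (piMap v)))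
    (h : (piMap (piMap v)).a1 ^ 2 * (piMap (piMap v)).f1 * (piMap (piMap v)).f2 - 1 ≠ 0) :
    Nz (s1 (piMap (piMap v))) := by
  rw [nz_s1_iff hpp, piMap_piMap_f1_mul_f2_sub hC hv hp]
  exact ⟨mul_ne_zero ((nz_s1_iff hv).mp hs).2 (div_ne_zero hp.2.2.2.2.2 hv.2.2.2.2.2), h⟩

lemma piMap_s1_f2 {v : Tup K} (hC : C v) (hv : Nz v) (hs : Nz (s1 v)) (hp : Nz (piMap v))
    (hpp : Nz (piMap (piMap v))) (hspp : Nz (s1 (piMap (piMap v)))) :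
    (piMap (s1 v)).f2 = (s1 (piMap (piMap v))).f1 := by
  have hX := piMap_piMap_f1_mul_f2_sub hC hv hp
  rw [nz_s1_iff hv] at hs
  rw [nz_s1_iff hpp] at hspp
  obtain ⟨a0, a1, b, q, f1, f2⟩ := v
  obtain ⟨-, h1, -, -, hf1, hf2⟩ := hv
  obtain ⟨-, -, -, -, -, hp⟩ := hp
  obtain ⟨hs1, hs2⟩ := hs
  obtain ⟨hspp1, hspp2⟩ := hspp
  simp only [C] at hC
  subst hC
  simp only [piMap, s1] at *
  set g := -(1 / f1) * (1 + a0 * a1 * a0 * b / f2) with hg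
  have hg' : f1 * f2 * g = -(f2 + a0 * a1 * a0 * b) := by rw [hg]; field_simp
  set k := -(1 / f2) * (1 + a0 * a1 * a1 * (a0 * a1 * b) / g) with hk
  have hkey : (a1 ^ 2 * g * k - 1) * f2 * (f1 * f2) =
      -((f1 * f2 - a1 ^ 2) * f2 + a0 * a1 * a0 * b * a1 ^ 2 * (a1 ^ 2 * f1 * f2 - 1)) := by
    field_simp at hX
    linear_combination a1 ^ 2 * f1 * f2 * hX + a1 ^ 2 * (a1 ^ 2 * f1 * f2 - 1) * hg'
  rw [hX]
  generalize f1 * f2 - a1 ^ 2 = D at *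
  generalize a1 ^ 2 * f1 * f2 - 1 = E at *
  generalize a1 ^ 2 * g * k - 1 = F at *
  clear_value g k
  field_simp
  linear_combination -hkey

lemma nz_piMap_s1 {v : Tup K} (hC : C v) (hv : Nz v) (hs : Nz (s1 v)) (hp : Nz (piMap v))
    (hpp : Nz (piMap (piMap v))) (hspp : Nz (s1 (piMap (piMap v)))) : Nz (piMap (s1 v)) :=
  ⟨hs.2.1, hs.1, mul_ne_zero hs.2.2.2.1 hs.2.2.1, hs.2.2.2.1, hs.2.2.2.2.2,
    piMap_s1_f2 hC hv hs hp hpp hspp ▸ hspp.2.2.2.2.1⟩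

lemma piMap_piMap_s1 {v : Tup K} (hC : C v) (hv : Nz v) (hs : Nz (s1 v)) (hp : Nz (piMap v))
    (hpp : Nz (piMap (piMap v))) (hspp : Nz (s1 (piMap (piMap v)))) :
    piMap (piMap (s1 v)) = s1 (piMap (piMap v)) := by
  have hf1 := piMap_s1_f2 hC hv hs hp hpp hspp
  have hps := nz_piMap_s1 hC hv hs hp hpp hspp
  have hX := piMap_piMap_f1_mul_f2_sub hC hv hp
  have hX' := piMap_piMap_f1_mul_f2_sub (hC.s1 hv) hs hps
  have hS : (s1 (piMap (piMap v))).f1 * (v.a1 ^ 2 * v.f1 * v.f2 - 1) =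
      ((piMap (piMap v)).a1 ^ 2 * (piMap (piMap v)).f1 * (piMap (piMap v)).f2 - 1) * v.f2 := by
    have h := ((nz_s1_iff hpp).mp hspp).1
    simp only [s1]
    rw [div_mul_eq_mul_div, div_eq_iff h, hX]
    have := hv.2.2.2.2.2
    change (piMap v).f2 * _ * _ = _
    field_simp
  have hf2 : (piMap (piMap (s1 v))).f2 = (s1 (piMap (piMap v))).f2 := by
    refine mul_left_cancel₀ hspp.2.2.2.2.1 ?_
    rw [s1_f1_mul_s1_f2 hpp hspp]
    have hprod := s1_f1_mul_s1_f2 hv hs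
    have h1 := hv.2.1
    have hf2 := hv.2.2.2.2.2
    obtain ⟨hD, hE⟩ := (nz_s1_iff hv).mp hs
    rw [hf1, mul_assoc, hprod] at hX'
    change (piMap (s1 v)).f2 * _ - v.a1⁻¹ ^ 2 = (v.a1⁻¹ ^ 2 * _ - 1) *
      (_ / (v.f2 * (v.f1 * v.f2 - v.a1 ^ 2) / (v.a1 ^ 2 * v.f1 * v.f2 - 1))) at hX'
    change _ = (v.a1 ^ 2 * _ * _ - 1) * _ at hS
    have hnum : v.a1⁻¹ ^ 2 * (v.f1 * v.f2) - 1 = (v.f1 * v.f2 - v.a1 ^ 2) / v.a1 ^ 2 := by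
      field_simp
    rw [hnum, hf1] at hX'
    generalize v.f1 * v.f2 - v.a1 ^ 2 = D at *
    generalize v.a1 ^ 2 * v.f1 * v.f2 - 1 = E at *
    field_simp at hX'
    refine mul_left_cancel₀ (mul_ne_zero (pow_ne_zero 2 h1) hf2) ?_
    linear_combination hX' + hS
  change (⟨_, _, _, _, (piMap (s1 v)).f2, (piMap (piMap (s1 v))).f2⟩ : Tup K) = _
  rw [hf1, hf2]
  rfl

lemma w0_w0 {v : Tup K} (hC : C v) (hv : Nz v) (hp : Nz (piMap v))
    (hpp : Nz (piMap (piMap v))) : w0 (w0 v) = v := by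
  simp only [w0]
  rw [piMap_w1_piMap hC.piMap hp hpp, piMap_w1_piMap hC hv hp, w1_w1 hv]

/-- The relations of the extended affine Weyl group of type `(A₁ × A₁)⁽¹⁾` for the birational
representation coming from the `(1,1,1)`-periodic reduction with `n = 2`: each relation holds
at every tuple (subject to `a₀a₁ = q`) at which all rational expressions arising in the
indicated composite are defined and nonzero. -/
theorem weyl_relations_A1A1 :
    (∀ v : Tup K, C v → okChain (s0L ++ s0L) v → s0 (s0 v) = v) ∧
    (∀ v : Tup K, C v → okChain [s1, s1] v → s1 (s1 v) = v) ∧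
    (∀ v : Tup K, C v → okChain (w0L ++ w0L) v → w0 (w0 v) = v) ∧
    (∀ v : Tup K, C v → okChain [w1, w1] v → w1 (w1 v) = v) ∧
    (∀ v : Tup K, C v → okChain (s0L ++ w0L ++ s0L ++ w0L) v → w0 (s0 (w0 (s0 v))) = v) ∧
    (∀ v : Tup K, C v → okChain ([s1] ++ w0L ++ [s1] ++ w0L) v → w0 (s1 (w0 (s1 v))) = v) ∧
    (∀ v : Tup K, C v → okChain (s0L ++ [w1] ++ s0L ++ [w1]) v → w1 (s0 (w1 (s0 v))) = v) ∧
    (∀ v : Tup K, C v → okChain [s1, w1, s1, w1] v → w1 (s1 (w1 (s1 v))) = v) ∧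
    (∀ v : Tup K, C v → okChain (rL ++ rL) v → r (r v) = v) := by
  refine ⟨?_, ?_, ?_, ?_, ?_, ?_, ?_, ?_, ?_⟩ <;> intro v hC h <;>
    simp only [s0L, w0L, rL, List.cons_append, List.nil_append, okChain] at h
  · obtain ⟨hv, hx, hu, hy, -⟩ := h
    simp only [s0]
    rw [piInv_piMap hu hy, s1_s1 hx hu, piMap_piInv hv hx]
  · exact s1_s1 h.1 h.2.1
  · exact w0_w0 hC h.1 h.2.1 h.2.2.1
  · exact w1_w1 h.1
  · obtain ⟨hv, hx, hu, hy, hy1, hy2, hw, hiw, hsw, -⟩ := h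
    have hvx := piMap_piInv hv hx
    have hxu := s1_s1 hx hu
    have hCx := hC.piInv
    have hCu := hCx.s1 hx
    simp only [s0, w0]
    set x := piInv v
    set u := s1 x
    have hCy2 := hCu.piMap.piMap.piMap
    rw [piInv_w1 hCy2 hy2] at hiw hsw ⊢
    have hy3 := nz_of_nz_w1 hiw
    rw [s1_w1 hy3] at hsw
    have hsy3 := nz_of_nz_w1 hsw
    have hsy1 : Nz (s1 (piMap (piMap u))) := by
      refine nz_s1_piMap_piMap hCu hu (hxu ▸ hx) hy hy1 fun h0 => ?_
      apply ((nz_s1_iff hy3).mp hsy3).1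
      rw [piMap_piMap_f1_mul_f2_sub hCu.piMap.piMap hy1 hy2, h0, zero_mul]
    have e1 := piMap_piMap_s1 hCu hu (hxu ▸ hx) hy hy1 hsy1
    have e2 := piMap_piMap_s1 hCu.piMap.piMap hy1 hsy1 hy2 hy3 hsy3
    have hv2 := nz_piMap_s1 hCu.piMap.piMap hy1 hsy1 hy2 hy3 hsy3
    rw [s1_w1 hy3, ← e2]
    rw [← e2] at hsy3
    rw [← e1, hxu, hvx] at hsy1 hv2 hsy3 ⊢
    rw [piMap_w1_piMap hC.piMap.piMap hv2 hsy3]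
    exact w0_w0 hC hv hsy1 hv2
  · obtain ⟨hv, hu, hy, hy1, hw, hsw, -⟩ := h
    have hvu := s1_s1 hv hu
    have hCu := hC.s1 hv
    simp only [w0] at hsw ⊢
    set u := s1 v
    rw [s1_w1 hy1] at hsw ⊢
    have hs := nz_of_nz_w1 hsw
    have e := piMap_piMap_s1 hCu hu (hvu ▸ hv) hy hy1 hs
    have hp := nz_piMap_s1 hCu hu (hvu ▸ hv) hy hy1 hs
    rw [← e, hvu] at hs ⊢
    rw [hvu] at hp
    exact w0_w0 hC hv hp hs
  · obtain ⟨hv, hx, hu, hy, hw, hiw, hsw, -⟩ := h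
    have hvx := piMap_piInv hv hx
    have hxu := s1_s1 hx hu
    have hCu := hC.piInv.s1 hx
    simp only [s0]
    set x := piInv v
    set u := s1 x
    rw [piInv_w1 hCu.piMap hy] at hiw hsw ⊢
    have hy1 := nz_of_nz_w1 hiw
    rw [s1_w1 hy1] at hsw ⊢
    have hs := nz_of_nz_w1 hsw
    have e := piMap_piMap_s1 hCu hu (hxu ▸ hx) hy hy1 hs
    rw [← e, hxu, hvx] at hs ⊢
    rw [piMap_w1_piMap hC hv hs, w1_w1 hv]
  · obtain ⟨hv, hu, -⟩ := h
    rw [s1_w1 hu, s1_s1 hv hu, w1_w1 hv]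
  · simp only [r]
    rw [piMap_w1_piMap hC h.1 h.2.1, w1_w1 h.1]

end WeylA1A1
end

section
/- Let K be a field and let u = (a0, a1, b, q, g1, g2) be a 6-tuple of nonzero elements of K with a0·a1 = q. Let π denote the map π(a0, a1, b, q, f1, f2) = (a1, a0, q·b, q, f2, −(1/f1)·(1 + q·a0·b/f2)), and suppose π can be applied twice to u with all intermediate entries defined and nonzero; write π(π(u)) = (a0, a1, q^2·b, q, f1, f2). Then g1 + 1/f1 = a1^{−2}·(f2 + 1/g2) and g2 + 1/f2 = −a1·(q^2·b)/(f1·f2). -/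
namespace QP2A6

/-- A 6-tuple `(a₀, a₁, b, q, f₁, f₂)` of elements of a field `K`. -/
structure Tup (K : Type*) where
  a0 : K
  a1 : K
  b : K
  q : K
  f1 : K
  f2 : K

variable {K : Type*} [Field K]

/-- All entries of the tuple are nonzero. -/
def Nz (v : Tup K) : Prop :=
  v.a0 ≠ 0 ∧ v.a1 ≠ 0 ∧ v.b ≠ 0 ∧ v.q ≠ 0 ∧ v.f1 ≠ 0 ∧ v.f2 ≠ 0

/-- The half-translation `π`. -/
def piMap (v : Tup K) : Tup K :=
  ⟨v.a1, v.a0, v.q * v.b, v.q, v.f2, -(1 / v.f1) * (1 + v.q * v.a0 * v.b / v.f2)⟩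

/-- In the `(1,1,1)`-periodic reduction with `n = 2`, the time evolution of the `q`-Painlevé
system is `T̂₀ = π⁻²`: writing `π(π(u)) = (a₀, a₁, q²b, q, f₁, f₂)` and
`u = (a₀, a₁, b, q, g₁, g₂)`, the components satisfy the system qP⁽²⁾(A₆⁽¹⁾)
(equivalent to the `q`-Painlevé II equation of `A₆⁽¹⁾`-surface type). -/
theorem qP2_A6_from_pi_sq (u : Tup K) (hC : u.a0 * u.a1 = u.q)
    (h0 : Nz u) (h1 : Nz (piMap u)) (h2 : Nz (piMap (piMap u))) :
    (piMap (piMap u)).a0 = u.a0 ∧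
    (piMap (piMap u)).a1 = u.a1 ∧
    (piMap (piMap u)).b = u.q ^ 2 * u.b ∧
    (piMap (piMap u)).q = u.q ∧
    u.f1 + 1 / (piMap (piMap u)).f1
      = (u.a1 ^ 2)⁻¹ * ((piMap (piMap u)).f2 + 1 / u.f2) ∧
    u.f2 + 1 / (piMap (piMap u)).f2
      = -u.a1 * (u.q ^ 2 * u.b) / ((piMap (piMap u)).f1 * (piMap (piMap u)).f2) := by
  obtain ⟨-, ha1, -, -, hg1, hg2⟩ := h0
  obtain ⟨-, -, -, -, -, hF1⟩ := h1
  obtain ⟨-, -, -, -, -, hF2⟩ := h2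
  obtain ⟨a0, a1, b, q, g1, g2⟩ := u
  simp only [piMap] at *
  set F1 := -(1 / g1) * (1 + q * a0 * b / g2) with hF1_def
  set F2 := -(1 / g2) * (1 + q * a1 * (q * b) / F1) with hF2_def
  have e1 : g1 * F1 * g2 = -(g2 + q * a0 * b) := by
    rw [hF1_def]
    field_simp
  have e2 : F2 * g2 * F1 = -(F1 + q ^ 2 * a1 * b) := by
    rw [hF2_def]
    field_simp
  clear_value F2 F1
  subst hC
  refine ⟨trivial, trivial, by ring, trivial, ?_, ?_⟩
  · field_simp
    linear_combination a1 ^ 2 * e1 - e2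
  · field_simp
    linear_combination e2

end QP2A6
end

section
/- Fix an integer N ≥ 2 and let K be a field. On tuples v = (a0,…,a_{2N−1}, b, q, f1,…,f_{2N}) of nonzero elements of K satisfying a0·a1···a_{2N−1} = q, define the (partially defined) maps, with indices of the a's read modulo 2N: for i = 1,…,2N−1, s_i replaces a_i by a_i^{−1}, a_{i−1} by a_{i−1}·a_i, a_{i+1} by a_i·a_{i+1}, f_i by f_i·(1 − a_i^{2N}·f_i·f_{i+1})/(a_i^{2N} − f_i·f_{i+1}) and f_{i+1} by f_{i+1}·(a_i^{2N} − f_i·f_{i+1})/(1 − a_i^{2N}·f_i·f_{i+1}), fixing all other components; π(v) = (a1,…,a_{2N−1}, a0, q·b, q, f2,…,f_{2N}, P) where P = −q^{2N−1}·a0·b/[(∏_{k=1}^{2N−2} a_k^{2N−k−1})·(∏_{k=1}^{2N} f_k)] − 1/f1; w1(v) has j-th a-component 1/a_{2N−j} (indices mod 2N), b-component q^{2N}·b, q-component q^{−1}, and j-th f-component f_{2N−j+1}. Then, at every tuple where all the rational expressions arising in the indicated composites are defined and nonzero: (1) s_i∘s_i = id (i = 1,…,2N−1); (2) s_i∘s_{i+1}∘s_i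 = s_{i+1}∘s_i∘s_{i+1} (i = 1,…,2N−2); (3) s_i∘s_j = s_j∘s_i whenever 1 ≤ i, j ≤ 2N−1 and |i−j| ≥ 2; (4) w1∘w1 = id; (5) w1∘s_k∘w1 = s_{2N−k} (k = 1,…,2N−1); (6) π∘s_k∘π^{−1} = s_{k−1} (k = 2,…,2N−1) and π∘π∘s_1∘π^{−1}∘π^{−1} = s_{2N−1}; (7) (π∘w1)∘(π∘w1) = id; (8) setting s0 = π∘s_1∘π^{−1}, the relations (1), (2), (3) and (5) hold for all indices read modulo 2N. -/
open Finset

namespace WeylA2Nm1A1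

/-- A tuple `(a₀, …, a_{2N−1}, b, q, f₁, …, f_{2N})`: the `a`-components are indexed
cyclically by `ZMod (2N)` and the `f`-components by the natural numbers `1, …, 2N`
(values of `f` outside this range are junk, untouched by all the maps below). -/
structure Tup (N : ℕ) (K : Type*) where
  a : ZMod (2 * N) → K
  b : K
  q : K
  f : ℕ → K

variable {N : ℕ} {K : Type*} [Field K]

/-- All entries of the tuple are nonzero. -/
def Nz (v : Tup N K) : Prop :=
  (∀ j : ZMod (2 * N), v.a j ≠ 0) ∧ v.b ≠ 0 ∧ v.q ≠ 0 ∧ ∀ j ∈ Icc 1 (2 * N), v.f j ≠ 0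

/-- The constraint `a₀·a₁···a_{2N−1} = q`. -/
def C (v : Tup N K) : Prop := (∏ k ∈ range (2 * N), v.a k) = v.q

/-- The map `s_i` (`i = 1, …, 2N−1`). -/
def sMap (i : ℕ) (v : Tup N K) : Tup N K where
  a := fun j =>
    if j = (i : ZMod (2 * N)) then (v.a j)⁻¹
    else if j = (i : ZMod (2 * N)) + 1 ∨ j = (i : ZMod (2 * N)) - 1 then
      v.a (i : ZMod (2 * N)) * v.a j
    else v.a j
  b := v.b
  q := v.q
  f := fun j =>
    if j = i then
      v.f i * (1 - v.a i ^ (2 * N) * v.f i * v.f (i + 1))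
        / (v.a i ^ (2 * N) - v.f i * v.f (i + 1))
    else if j = i + 1 then
      v.f (i + 1) * (v.a i ^ (2 * N) - v.f i * v.f (i + 1))
        / (1 - v.a i ^ (2 * N) * v.f i * v.f (i + 1))
    else v.f j

/-- The last `f`-component of `π`. -/
def Pval (v : Tup N K) : K :=
  -(v.q ^ (2 * N - 1) * v.a 0 * v.b)
      / ((∏ k ∈ Icc 1 (2 * N - 2), v.a k ^ (2 * N - k - 1)) * ∏ k ∈ Icc 1 (2 * N), v.f k)
    - 1 / v.f 1

/-- The map `π`. -/
def piMap (v : Tup N K) : Tup N K where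
  a := fun j => v.a (j + 1)
  b := v.q * v.b
  q := v.q
  f := fun j =>
    if 1 ≤ j ∧ j ≤ 2 * N - 1 then v.f (j + 1) else if j = 2 * N then Pval v else v.f j

/-- The (partial, birational) inverse of `π`. -/
def piInv (v : Tup N K) : Tup N K where
  a := fun j => v.a (j - 1)
  b := v.b / v.q
  q := v.q
  f := fun j =>
    if j = 1 then
      -(v.q ^ (2 * N - 1) * v.a (-1) * (v.b / v.q)
            / ((∏ k ∈ Icc 1 (2 * N - 2), v.a ((k : ZMod (2 * N)) - 1) ^ (2 * N - k - 1)) *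
                ∏ k ∈ Icc 1 (2 * N - 1), v.f k)
          + 1) / v.f (2 * N)
    else if 2 ≤ j ∧ j ≤ 2 * N then v.f (j - 1)
    else v.f j

/-- The map `w₁`. -/
def w1 (v : Tup N K) : Tup N K where
  a := fun j => (v.a (-j))⁻¹
  b := v.q ^ (2 * N) * v.b
  q := v.q⁻¹
  f := fun j => if 1 ≤ j ∧ j ≤ 2 * N then v.f (2 * N - j + 1) else v.f j

/-- Application of a chain of maps (in application order). -/
def apChain : List (Tup N K → Tup N K) → Tup N K → Tup N K
  | [], v => v
  | f :: fs, v => apChain fs (f v)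

/-- All tuples appearing along a chain of maps have nonzero entries (in particular all
denominators arising in the composite are nonzero). -/
def okChain : List (Tup N K → Tup N K) → Tup N K → Prop
  | [], v => Nz v
  | f :: fs, v => Nz v ∧ okChain fs (f v)

/-- The chain (in application order) representing `s_i` for `i ∈ ℤ/2Nℤ`:
for `i ≠ 0` it is `s_i` itself, and for `i = 0` it is `s₀ = π ∘ s₁ ∘ π⁻¹`. -/
def sL (i : ZMod (2 * N)) : List (Tup N K → Tup N K) :=
  if i = 0 then [piInv, sMap 1, piMap] else [sMap i.val]

/-- The family `s_i`, `i ∈ ℤ/2Nℤ`, with `s₀ = π ∘ s₁ ∘ π⁻¹`. -/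
def sFam (i : ZMod (2 * N)) (v : Tup N K) : Tup N K := apChain (sL i) v

/-- The first of the two coordinates changed by `s_i`, with `A = a_i ^ n`. -/
def fstF (A x y : K) : K := x * (1 - A * x * y) / (A - x * y)

/-- The second of the two coordinates changed by `s_i`, with `A = a_i ^ n`. -/
def sndF (A x y : K) : K := y * (A - x * y) / (1 - A * x * y)

theorem fstF_ne {A x y : K} (h : fstF A x y ≠ 0) : A - x * y ≠ 0 ∧ 1 - A * x * y ≠ 0 := by
  constructor <;> intro h0 <;> exact h (by simp [fstF, h0])

theorem fstF_sndF_eq {A x y D E w : K} (hw : w ≠ 0) (hD : w * (A - x * y) = D)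
    (hE : w * (1 - A * x * y) = E) : fstF A x y = x * E / D ∧ sndF A x y = y * D / E := by
  subst hD hE
  constructor
  · rw [fstF, mul_left_comm, mul_div_mul_left _ _ hw]
  · rw [sndF, mul_left_comm, mul_div_mul_left _ _ hw]

theorem fstF_sndF_eq_ne {A x y D E w : K} (hw : w ≠ 0) (hD : w * (A - x * y) = D)
    (hE : w * (1 - A * x * y) = E) (h : fstF A x y ≠ 0) :
    (D ≠ 0 ∧ E ≠ 0) ∧ fstF A x y = x * E / D ∧ sndF A x y = y * D / E := by
  refine ⟨?_, fstF_sndF_eq hw hD hE⟩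
  subst hD hE
  exact ⟨mul_ne_zero hw (fstF_ne h).1, mul_ne_zero hw (fstF_ne h).2⟩

theorem fstF_mul_sndF {A x y : K} (h : fstF A x y ≠ 0) :
    fstF A x y * sndF A x y = x * y := by
  obtain ⟨⟨hD, hE⟩, h1, h2⟩ := fstF_sndF_eq_ne one_ne_zero rfl rfl h
  rw [h1, h2, div_mul_div_comm, mul_mul_mul_comm, mul_comm (1 * (A - x * y)), mul_div_assoc,
    div_self (mul_ne_zero hE hD), mul_one]

theorem fstF_invol {A x y : K} (hA : A ≠ 0) (h : fstF A x y ≠ 0) :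
    fstF A⁻¹ (fstF A x y) (sndF A x y) = x ∧ sndF A⁻¹ (fstF A x y) (sndF A x y) = y := by
  have e := fstF_mul_sndF h
  obtain ⟨⟨hD, hE⟩, h1, h2⟩ := fstF_sndF_eq_ne one_ne_zero rfl rfl h
  obtain ⟨h3, h4⟩ := fstF_sndF_eq (A := A⁻¹) (x := fstF A x y) (y := sndF A x y)
    (D := 1 * (1 - A * x * y)) (E := 1 * (A - x * y)) hA
    (by rw [e]; field_simp) (by rw [mul_assoc A⁻¹, e]; field_simp)
  rw [h3, h4, h1, h2]
  generalize 1 * (A - x * y) = D at *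
  generalize 1 * (1 - A * x * y) = E at *
  constructor <;> field_simp

theorem braid_left {A B x y z : K}
    (n1 : fstF A x y ≠ 0) (n2 : fstF (A * B) (sndF A x y) z ≠ 0)
    (n3 : fstF B (fstF A x y) (fstF (A * B) (sndF A x y) z) ≠ 0) :
    fstF B (fstF A x y) (fstF (A * B) (sndF A x y) z) =
      x * (B - A * B * x * y - y * z + A * B ^ 2 * x * y ^ 2 * z) /
        (A * B ^ 2 - x * y - B * y * z * (A - x * y)) ∧
    sndF B (fstF A x y) (fstF (A * B) (sndF A x y) z) =
      y * (1 - A * x * y - A * B * y * (A - x * y) * z) *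
        (A * B ^ 2 - x * y - B * y * z * (A - x * y)) /
      ((A * B * (1 - A * x * y) - y * (A - x * y) * z) *
        (B - A * B * x * y - y * z + A * B ^ 2 * x * y ^ 2 * z)) ∧
    sndF (A * B) (sndF A x y) z = z * (A * B * (1 - A * x * y) - y * (A - x * y) * z) /
        (1 - A * x * y - A * B * y * (A - x * y) * z) := by
  obtain ⟨d, hd'⟩ : ∃ d, d = A - x * y := ⟨_, rfl⟩
  obtain ⟨e, he'⟩ : ∃ e, e = 1 - A * x * y := ⟨_, rfl⟩
  obtain ⟨⟨hd, he⟩, h1, h2⟩ := fstF_sndF_eq_ne (D := d) (E := e) one_ne_zero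
    (by rw [hd', one_mul]) (by rw [he', one_mul]) n1
  rw [← hd', ← he']
  obtain ⟨P, hP'⟩ : ∃ P, P = A * B * e - y * d * z := ⟨_, rfl⟩
  obtain ⟨Q, hQ'⟩ : ∃ Q, Q = e - A * B * y * d * z := ⟨_, rfl⟩
  obtain ⟨⟨hP, hQ⟩, h3, h4⟩ := fstF_sndF_eq_ne (w := e) (D := P) (E := Q) he
    (by rw [h2, hP']; field_simp) (by rw [h2, hQ']; field_simp) n2
  obtain ⟨S, hS'⟩ : ∃ S, S = A * B ^ 2 - x * y - B * y * z * d := ⟨_, rfl⟩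
  obtain ⟨R, hR'⟩ : ∃ S, S = B - A * B * x * y - y * z + A * B ^ 2 * x * y ^ 2 * z := ⟨_, rfl⟩
  rw [← hP', ← hQ', ← hR', ← hS']
  have hxy : P * (fstF A x y * fstF (A * B) (sndF A x y) z) = x * y * Q := by
    rw [h3, h1, h2]; field_simp
  obtain ⟨⟨hS, hR⟩, h5, h6⟩ := fstF_sndF_eq_ne (w := P) (D := e * S)
    (E := d * R) hP (by rw [mul_sub, hxy]; subst_vars; ring)
      (by rw [mul_sub, mul_assoc B, mul_left_comm, hxy]; subst_vars; ring) n3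
  have hS := right_ne_zero_of_mul hS
  have hR := right_ne_zero_of_mul hR
  refine ⟨?_, ?_, h4⟩
  · rw [h5, h1]; field_simp
  · rw [h6, h3, h2]; field_simp

theorem braid_right {A B x y z : K}
    (n1 : fstF B y z ≠ 0) (n2 : fstF (A * B) x (fstF B y z) ≠ 0)
    (n3 : fstF A (sndF (A * B) x (fstF B y z)) (sndF B y z) ≠ 0) :
    fstF (A * B) x (fstF B y z) =
      x * (B - A * B * x * y - y * z + A * B ^ 2 * x * y ^ 2 * z) /
        (A * B ^ 2 - x * y - B * y * z * (A - x * y)) ∧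
    fstF A (sndF (A * B) x (fstF B y z)) (sndF B y z) =
      y * (1 - A * x * y - A * B * y * (A - x * y) * z) *
        (A * B ^ 2 - x * y - B * y * z * (A - x * y)) /
      ((A * B * (1 - A * x * y) - y * (A - x * y) * z) *
        (B - A * B * x * y - y * z + A * B ^ 2 * x * y ^ 2 * z)) ∧
    sndF A (sndF (A * B) x (fstF B y z)) (sndF B y z) =
      z * (A * B * (1 - A * x * y) - y * (A - x * y) * z) /
        (1 - A * x * y - A * B * y * (A - x * y) * z) := by
  obtain ⟨d, hd'⟩ : ∃ d, d = B - y * z := ⟨_, rfl⟩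
  obtain ⟨e, he'⟩ : ∃ e, e = 1 - B * y * z := ⟨_, rfl⟩
  obtain ⟨⟨hd, he⟩, h1, h2⟩ := fstF_sndF_eq_ne (D := d) (E := e) one_ne_zero
    (by rw [hd', one_mul]) (by rw [he', one_mul]) n1
  obtain ⟨P, hP'⟩ : ∃ d, d = A * B * (1 - A * x * y) - y * (A - x * y) * z := ⟨_, rfl⟩
  obtain ⟨Q, hQ'⟩ : ∃ d, d = 1 - A * x * y - A * B * y * (A - x * y) * z := ⟨_, rfl⟩
  obtain ⟨S, hS'⟩ : ∃ S, S = A * B ^ 2 - x * y - B * y * z * (A - x * y) := ⟨_, rfl⟩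
  obtain ⟨R, hR'⟩ : ∃ S, S = B - A * B * x * y - y * z + A * B ^ 2 * x * y ^ 2 * z := ⟨_, rfl⟩
  rw [← hP', ← hQ', ← hR', ← hS']
  obtain ⟨⟨hS, hR⟩, h3, h4⟩ := fstF_sndF_eq_ne (w := d) (D := S) (E := R) hd
    (by rw [h1]; field_simp; subst_vars; ring) (by rw [h1]; field_simp; subst_vars; ring) n2
  have hyz : R * (sndF (A * B) x (fstF B y z) * sndF B y z) = y * z * S := by
    rw [h4, h1, h2]; field_simp
  obtain ⟨⟨hP, hQ⟩, h5, h6⟩ := fstF_sndF_eq_ne (w := R) (D := e * P)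
    (E := d * Q) hR (by rw [mul_sub, hyz]; subst_vars; ring)
      (by rw [mul_sub, mul_assoc A, mul_left_comm, hyz]; subst_vars; ring) n3
  have hP := right_ne_zero_of_mul hP
  have hQ := right_ne_zero_of_mul hQ
  refine ⟨h3, ?_, ?_⟩
  · rw [h5, h4, h1]; field_simp
  · rw [h6, h2]; field_simp

section refl

variable {R : Type*} [CommRing R] [DecidableEq R]

/-- The simple reflection acting on multiplicative root variables with a cyclic diagram. -/
def aRefl (i : R) (α : R → K) : R → K := fun j =>
  if j = i then (α j)⁻¹ else if j = i + 1 ∨ j = i - 1 then α i * α j else α j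

theorem aRefl_invol (i : R) (α : R → K) (hα : α i ≠ 0) :
    aRefl i (aRefl i α) = α := by
  funext j; unfold aRefl; grind

theorem aRefl_comm {i j : R} (α : R → K) (h1 : j ≠ i) (h2 : j ≠ i + 1) (h3 : j ≠ i - 1) :
    aRefl i (aRefl j α) = aRefl j (aRefl i α) := by
  funext l; unfold aRefl; grind

theorem aRefl_braid (i : R) (α : R → K) (hα : ∀ i, α i ≠ 0) :
    aRefl i (aRefl (i + 1) (aRefl i α)) = aRefl (i + 1) (aRefl i (aRefl (i + 1) α)) := by
  funext j
  have := hα i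
  have := hα (i + 1)
  unfold aRefl; grind

end refl

section scalar

/-- The first `f`-coordinate of `s₀`, as a function of `f₁` and `f_n`. -/
def fstZ (A T x y : K) : K := x * (x + A * y + T) / (A * x + y + A * T)

/-- The last `f`-coordinate of `s₀`, as a function of `f₁` and `f_n`. -/
def sndZ (A T x y : K) : K := y * (x + A * y + A ^ 2 * T) / (A * x + y + A * T)

theorem fstZ_sndZ_eq {A T x y w X D Y : K} (hw : w ≠ 0) (hX : w * (x + A * y + T) = X)
    (hD : w * (A * x + y + A * T) = D) (hY : w * (x + A * y + A ^ 2 * T) = Y) :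
    fstZ A T x y = x * X / D ∧ sndZ A T x y = y * Y / D := by
  subst hX hD hY
  constructor
  · rw [fstZ, mul_left_comm, mul_div_mul_left _ _ hw]
  · rw [sndZ, mul_left_comm, mul_div_mul_left _ _ hw]

theorem fstZ_sndZ_eq_ne {A T x y w X D Y : K} (hw : w ≠ 0) (hX : w * (x + A * y + T) = X)
    (hD : w * (A * x + y + A * T) = D) (hY : w * (x + A * y + A ^ 2 * T) = Y)
    (h : fstZ A T x y ≠ 0) (h' : sndZ A T x y ≠ 0) :
    (X ≠ 0 ∧ D ≠ 0 ∧ Y ≠ 0) ∧ fstZ A T x y = x * X / D ∧ sndZ A T x y = y * Y / D := by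
  obtain ⟨h1, h2⟩ := fstZ_sndZ_eq hw hX hD hY
  refine ⟨⟨?_, ?_, ?_⟩, h1, h2⟩ <;> rintro rfl
  · exact h (by simp [h1])
  · exact h (by simp [h1])
  · exact h' (by simp [h2])

theorem fstZ_invol {A T x y : K} (hA : A ≠ 0) (h : fstZ A T x y ≠ 0) (h' : sndZ A T x y ≠ 0) :
    fstZ A⁻¹ (A * T) (fstZ A T x y) (sndZ A T x y) = x ∧
      sndZ A⁻¹ (A * T) (fstZ A T x y) (sndZ A T x y) = y := by
  obtain ⟨X, hX'⟩ : ∃ X, X = x + A * y + T := ⟨_, rfl⟩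
  obtain ⟨D, hD'⟩ : ∃ D, D = A * x + y + A * T := ⟨_, rfl⟩
  obtain ⟨Y, hY'⟩ : ∃ Y, Y = x + A * y + A ^ 2 * T := ⟨_, rfl⟩
  obtain ⟨⟨hX, hD, hY⟩, h1, h2⟩ := fstZ_sndZ_eq_ne (X := X) (D := D) (Y := Y) one_ne_zero
    (by rw [hX', one_mul]) (by rw [hD', one_mul]) (by rw [hY', one_mul]) h h'
  obtain ⟨h3, h4⟩ := fstZ_sndZ_eq (A := A⁻¹) (T := A * T) (x := fstZ A T x y)
    (y := sndZ A T x y) (w := A * D) (X := D * Y) (D := X * Y) (Y := D * X) (mul_ne_zero hA hD)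
    (by rw [h1, h2]; field_simp; subst_vars; ring)
    (by rw [h1, h2]; field_simp; subst_vars; ring)
    (by rw [h1, h2]; field_simp; subst_vars; ring)
  rw [h3, h4, h1, h2]
  constructor <;> field_simp

theorem braidZ {A B U x y z : K} (hA : A ≠ 0) (hz : z ≠ 0)
    {x₁ y₁ x₂ z₂ x₃ y₃ x₄ z₄ x₅ y₅ x₆ z₆ : K}
    (e1 : x₁ = fstZ A (U / z) x y) (e2 : y₁ = sndZ A (U / z) x y)
    (e3 : x₂ = fstF (A * B) x₁ z) (e4 : z₂ = sndF (A * B) x₁ z)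
    (e5 : x₃ = fstZ B (A * U / z₂) x₂ y₁) (e6 : y₃ = sndZ B (A * U / z₂) x₂ y₁)
    (g1 : x₄ = fstF B x z) (g2 : z₄ = sndF B x z)
    (g3 : x₅ = fstZ (A * B) (U / z₄) x₄ y) (g4 : y₅ = sndZ (A * B) (U / z₄) x₄ y)
    (g5 : x₆ = fstF A x₅ z₄) (g6 : z₆ = sndF A x₅ z₄)
    (n1 : x₁ ≠ 0) (n2 : y₁ ≠ 0) (n3 : x₂ ≠ 0)
    (n7 : x₄ ≠ 0) (n9 : x₅ ≠ 0) (n10 : y₅ ≠ 0) (n11 : x₆ ≠ 0) :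
    x₃ = x₆ ∧ y₃ = y₅ ∧ z₂ = z₆ := by
  obtain ⟨T, rfl⟩ : ∃ T, U = T * z := ⟨U / z, by field_simp⟩
  rw [mul_div_cancel_right₀ _ hz] at e1 e2
  obtain ⟨X, hX'⟩ : ∃ X, X = x + A * y + T := ⟨_, rfl⟩
  obtain ⟨D, hD'⟩ : ∃ D, D = A * x + y + A * T := ⟨_, rfl⟩
  obtain ⟨Y, hY'⟩ : ∃ Y, Y = x + A * y + A ^ 2 * T := ⟨_, rfl⟩
  obtain ⟨⟨hX, hD, hY⟩, h1, h2⟩ := fstZ_sndZ_eq_ne (X := X) (D := D) (Y := Y) one_ne_zero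
    (by rw [hX', one_mul]) (by rw [hD', one_mul]) (by rw [hY', one_mul]) (e1 ▸ n1) (e2 ▸ n2)
  rw [← e1] at h1
  rw [← e2] at h2
  obtain ⟨P, hP'⟩ : ∃ P, P = A * B * D - x * z * X := ⟨_, rfl⟩
  obtain ⟨Q, hQ'⟩ : ∃ Q, Q = D - A * B * x * z * X := ⟨_, rfl⟩
  obtain ⟨⟨hP, hQ⟩, h3, h4⟩ := fstF_sndF_eq_ne (w := D) (D := P) (E := Q) hD
    (by rw [h1, hP']; field_simp) (by rw [h1, hQ']; field_simp) (e3 ▸ n3)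
  rw [← e3] at h3
  rw [← e4] at h4
  obtain ⟨d, hd'⟩ : ∃ d, d = B - x * z := ⟨_, rfl⟩
  obtain ⟨e, he'⟩ : ∃ e, e = 1 - B * x * z := ⟨_, rfl⟩
  obtain ⟨⟨hd, he⟩, k1, k2⟩ := fstF_sndF_eq_ne (D := d) (E := e) one_ne_zero
    (by rw [hd', one_mul]) (by rw [he', one_mul]) (g1 ▸ n7)
  rw [← g1] at k1
  rw [← g2] at k2
  have hT : T * z / z₄ = T * e / d := by rw [k2]; field_simp
  rw [hT] at g3 g4
  obtain ⟨n, hn'⟩ : ∃ n, n = x * e + A * B * y * d + T * e := ⟨_, rfl⟩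
  obtain ⟨m, hm'⟩ : ∃ m, m = A * B * x * e + y * d + A * B * T * e := ⟨_, rfl⟩
  obtain ⟨l, hl'⟩ : ∃ l, l = x * e + A * B * y * d + A ^ 2 * B ^ 2 * T * e := ⟨_, rfl⟩
  obtain ⟨⟨hn, hm, hl⟩, k3, k4⟩ := fstZ_sndZ_eq_ne (w := d) (X := n) (D := m) (Y := l) hd
    (by rw [k1, hn']; field_simp) (by rw [k1, hm']; field_simp)
    (by rw [k1, hl']; field_simp) (g3 ▸ n9) (g4 ▸ n10)
  rw [← g3] at k3
  rw [← g4] at k4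
  have hxz : m * (x₅ * z₄) = x * z * n := by rw [k3, k1, k2]; field_simp
  obtain ⟨-, k5, k6⟩ := fstF_sndF_eq_ne (w := m) (D := e * P) (E := d * Q) hm
    (by rw [mul_sub, hxz]; subst_vars; ring)
    (by rw [mul_sub, mul_assoc A, mul_left_comm, hxz]; subst_vars; ring) (g5 ▸ n11)
  rw [← g5] at k5
  rw [← g6] at k6
  have hT2 : A * (T * z) / z₂ = A * T * Q / P := by rw [h4]; field_simp
  rw [hT2] at e5 e6
  obtain ⟨h5, h6⟩ := fstZ_sndZ_eq (A := B) (T := A * T * Q / P) (x := x₂) (y := y₁)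
    (w := D * P) (X := n * D * Y) (D := m * X * Y) (Y := l * D * X) (mul_ne_zero hD hP)
    (by rw [h3, h2, h1]; field_simp; subst_vars; ring)
    (by rw [h3, h2, h1]; field_simp; subst_vars; ring)
    (by rw [h3, h2, h1]; field_simp; subst_vars; ring)
  rw [← e5] at h5
  rw [← e6] at h6
  refine ⟨?_, ?_, ?_⟩
  · rw [h5, k5, h3, h1, k3, k1]; field_simp
  · rw [h6, k4, h2]; field_simp
  · rw [h4, k6, k2]; field_simp

end scalar

section cyclic

theorem natCast_ne_zero_of_lt {n k : ℕ} (hk : k ≠ 0) (h : k < n) : (k : ZMod n) ≠ 0 := by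
  rw [Ne, ZMod.natCast_eq_zero_iff]
  exact fun hd => absurd (Nat.le_of_dvd (Nat.pos_of_ne_zero hk) hd) (by omega)

theorem one_ne_zero_zmod (hN : 2 ≤ N) : (1 : ZMod (2 * N)) ≠ 0 := by
  exact_mod_cast natCast_ne_zero_of_lt (n := 2 * N) one_ne_zero (by omega)

theorem two_ne_zero_zmod (hN : 2 ≤ N) : (2 : ZMod (2 * N)) ≠ 0 := by
  exact_mod_cast natCast_ne_zero_of_lt (n := 2 * N) two_ne_zero (by omega)

theorem prod_range_natCast {M : Type*} [CommMonoid M] {n : ℕ} [NeZero n] (g : ZMod n → M) :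
    ∏ k ∈ range n, g k = ∏ j, g j :=
  Finset.prod_nbij' (fun k => (k : ZMod n)) ZMod.val (by simp)
    (fun j _ => mem_range.2 (ZMod.val_lt j))
    (fun k hk => ZMod.val_natCast_of_lt (mem_range.1 hk)) (by simp) (by simp)

theorem val_natCast_sub_one {n k : ℕ} (hk : 1 ≤ k) (hkn : k ≤ n) :
    ((k : ZMod n) - 1).val = k - 1 := by
  have : (k : ZMod n) - 1 = ((k - 1 : ℕ) : ZMod n) := by push_cast [hk]; ring
  rw [this, ZMod.val_natCast_of_lt (by omega)]

theorem val_sub_one {n : ℕ} [NeZero n] (j : ZMod n) (hj : j ≠ 0) :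
    (j - 1).val + 1 = j.val := by
  have h := val_natCast_sub_one (n := n) (k := j.val)
    (Nat.one_le_iff_ne_zero.2 (by simpa using hj)) (ZMod.val_lt j).le
  rw [ZMod.natCast_zmod_val] at h
  have : j.val ≠ 0 := by simpa using hj
  omega

theorem val_zero_sub_one {n : ℕ} [NeZero n] : ((0 : ZMod n) - 1).val + 1 = n := by
  have h := val_natCast_sub_one (n := n) (k := n) NeZero.one_le le_rfl
  rw [ZMod.natCast_self] at h
  have : 1 ≤ n := NeZero.one_le
  omega

theorem prod_aRefl_pow {R : Type*} [CommRing R] [DecidableEq R] [Fintype R] (i : R) (α : R → K)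
    (e : R → ℕ) (h1 : (1 : R) ≠ 0) (h2 : (2 : R) ≠ 0) (hα : α i ≠ 0) :
    (∏ j, aRefl i α j ^ e j) * α i ^ (2 * e i) =
      (∏ j, α j ^ e j) * α i ^ (e (i + 1) + e (i - 1)) := by
  have key : ∀ j, aRefl i α j ^ e j * (if j = i then α i ^ (2 * e i) else 1) =
      α j ^ e j * ((if j = i + 1 then α i ^ e (i + 1) else 1) *
        (if j = i - 1 then α i ^ e (i - 1) else 1)) := by
    intro j
    have a1 : i ≠ i + 1 := fun h => h1 (by linear_combination -h)
    have a2 : i ≠ i - 1 := fun h => h1 (by linear_combination h)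
    have a3 : i + 1 ≠ i - 1 := fun h => h2 (by linear_combination h)
    by_cases c1 : j = i
    · subst c1
      simp only [aRefl, if_true, if_neg a1, if_neg a2, mul_one]
      rw [two_mul, pow_add, ← mul_assoc, ← mul_pow, inv_mul_cancel₀ hα, one_pow, one_mul]
    by_cases c2 : j = i + 1
    · subst c2
      simp only [aRefl, if_true, if_neg a1.symm, if_neg a3, mul_one, true_or, mul_pow]
      rw [mul_comm]
    by_cases c3 : j = i - 1
    · subst c3
      simp only [aRefl, if_true, if_neg a2.symm, if_neg a3.symm, mul_one, or_true, mul_pow,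
        one_mul]
      rw [mul_comm]
    · simp [aRefl, c1, c2, c3]
  have := Finset.prod_congr (rfl : (univ : Finset R) = univ) fun j _ => key j
  simpa only [Finset.prod_mul_distrib, pow_add, Finset.prod_ite_eq', mem_univ, if_true] using this

end cyclic

section weights

variable [NeZero N]

/-- The weight `∏ aⱼ ^ j` over `0 ≤ j < 2N`. -/
def wtLow (α : ZMod (2 * N) → K) : K := ∏ j, α j ^ j.val

/-- The weight `∏ aⱼ ^ j` over `1 ≤ j ≤ 2N`. -/
def wtHigh (α : ZMod (2 * N) → K) : K := ∏ j, α j ^ ((j - 1).val + 1)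

theorem wtHigh_eq (α : ZMod (2 * N) → K) : wtHigh α = α 0 ^ (2 * N) * wtLow α := by
  have : ∀ j : ZMod (2 * N), α j ^ ((j - 1).val + 1) =
      (if j = 0 then α 0 ^ (2 * N) else 1) * α j ^ j.val := by
    intro j
    by_cases hj : j = 0
    · subst hj; simp only [val_zero_sub_one, if_true, ZMod.val_zero, pow_zero, mul_one]
    · rw [val_sub_one j hj, if_neg hj, one_mul]
  simp only [wtHigh, wtLow, this, Finset.prod_mul_distrib, Finset.prod_ite_eq', mem_univ, if_true]

theorem wtHigh_shift (α : ZMod (2 * N) → K) :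
    wtHigh (fun j => α (j - 1)) = (∏ j, α j) * wtLow α := by
  have h := Equiv.prod_comp (Equiv.subRight (1 : ZMod (2 * N))) fun j => α j ^ (j.val + 1)
  simp only [Equiv.subRight_apply] at h
  rw [wtHigh, h]
  simp [pow_succ, Finset.prod_mul_distrib, wtLow, mul_comm]

theorem wtLow_inv_neg (α : ZMod (2 * N) → K) (hα : ∀ j, α j ≠ 0) :
    (∏ j, α j) ^ (2 * N) * wtLow (fun j => (α (-j))⁻¹) = wtHigh α := by
  have h : wtLow (fun j => (α (-j))⁻¹) = ∏ j, (α j)⁻¹ ^ (-j).val := by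
    rw [wtLow, ← Equiv.prod_comp (Equiv.neg _)]
    simp
  rw [h, wtHigh_eq, ← Finset.prod_pow, ← Finset.prod_mul_distrib, wtLow,
    ← Finset.prod_erase_mul univ _ (mem_univ 0), ← Finset.prod_erase_mul univ _ (mem_univ 0)]
  simp only [neg_zero, ZMod.val_zero, pow_zero, mul_one]
  rw [mul_comm]
  congr 1
  refine Finset.prod_congr rfl fun j hj => ?_
  have hj := ne_of_mem_erase hj
  have hlt := (ZMod.val_lt j).le
  rw [ZMod.neg_val, if_neg hj, inv_pow, ← pow_sub₀ _ (hα j) (Nat.sub_le _ _),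
    Nat.sub_sub_self hlt]

theorem prod_pow_mul_zero (hN : 2 ≤ N) (α : ZMod (2 * N) → K) :
    (∏ j, α j) ^ (2 * N - 1) * α 0 =
      (∏ k ∈ Icc 1 (2 * N - 2), α k ^ (2 * N - k - 1)) * wtHigh α := by
  have h1 : (∏ k ∈ Icc 1 (2 * N - 2), α k ^ (2 * N - k - 1)) =
      ∏ k ∈ range (2 * N),
        α k ^ (if (k : ZMod (2 * N)) = 0 then 0 else 2 * N - (k : ZMod (2 * N)).val - 1) := by
    refine Finset.prod_subset_one_on_sdiff ?_ ?_ ?_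
    · intro k; simp only [mem_Icc, mem_range]; omega
    · intro k hk
      simp only [mem_sdiff, mem_Icc, mem_range] at hk
      rw [ZMod.val_natCast_of_lt hk.1]
      obtain rfl | h : k = 0 ∨ 2 * N - k - 1 = 0 := by omega
      · simp
      · simp [h]
    · intro k hk
      rw [mem_Icc] at hk
      rw [ZMod.val_natCast_of_lt (by omega),
        if_neg (natCast_ne_zero_of_lt (by omega) (by omega))]
  rw [h1, prod_range_natCast fun j => α j ^ (if j = 0 then 0 else 2 * N - j.val - 1), wtHigh,
    ← Finset.prod_mul_distrib]
  have h2 : ∀ j : ZMod (2 * N), α j ^ (if j = 0 then 0 else 2 * N - j.val - 1) *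
      α j ^ ((j - 1).val + 1) = α j ^ (2 * N - 1) * (if j = 0 then α j else 1) := by
    intro j
    by_cases hj : j = 0
    · subst hj
      rw [val_zero_sub_one, if_pos rfl, if_pos rfl, pow_zero, one_mul, ← pow_succ]
      congr 1; omega
    · rw [val_sub_one j hj, if_neg hj, if_neg hj, mul_one, ← pow_add]
      have := ZMod.val_lt j
      congr 1; omega
  simp only [h2, Finset.prod_mul_distrib, Finset.prod_pow, Finset.prod_ite_eq', mem_univ, if_true]

theorem wtHigh_aRefl (hN : 2 ≤ N) {i : ℕ} (hi : i ∈ Icc 2 (2 * N - 1)) (α : ZMod (2 * N) → K)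
    (hα : α i ≠ 0) : wtHigh (aRefl (i : ZMod (2 * N)) α) = wtHigh α := by
  rw [mem_Icc] at hi
  have h := prod_aRefl_pow (i : ZMod (2 * N)) α (fun j => (j - 1).val + 1)
    (one_ne_zero_zmod hN) (two_ne_zero_zmod hN) hα
  have e1 : ((i : ZMod (2 * N)) + 1 - 1).val + 1 = i + 1 := by
    rw [add_sub_cancel_right, ZMod.val_natCast_of_lt (by omega)]
  have e2 : ((i : ZMod (2 * N)) - 1).val + 1 = i := by
    rw [val_natCast_sub_one] <;> omega
  have e3 : ((i : ZMod (2 * N)) - 1 - 1).val + 1 = i - 1 := by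
    have : (i : ZMod (2 * N)) - 1 = ((i - 1 : ℕ) : ZMod (2 * N)) := by
      rw [Nat.cast_sub (by omega), Nat.cast_one]
    rw [this, val_natCast_sub_one] <;> omega
  simp only [e1, e2, e3] at h
  rw [show i + 1 + (i - 1) = 2 * i by omega] at h
  exact mul_right_cancel₀ (pow_ne_zero _ hα) h

theorem wtHigh_aRefl_one (hN : 2 ≤ N) (α : ZMod (2 * N) → K)
    (hα : α 1 ≠ 0) : wtHigh (aRefl 1 α) = wtHigh α * α 1 ^ (2 * N) := by
  have h := prod_aRefl_pow 1 α (fun j => (j - 1).val + 1)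
    (one_ne_zero_zmod hN) (two_ne_zero_zmod hN) hα
  have e1 : ((1 : ZMod (2 * N)) + 1 - 1).val = 1 := by
    rw [add_sub_cancel_right, ZMod.val_one'' (by omega)]
  simp only [e1, sub_self, val_zero_sub_one, ZMod.val_zero] at h
  rw [add_comm (1 + 1), pow_add, ← mul_assoc] at h
  exact mul_right_cancel₀ (pow_ne_zero _ hα) h

theorem wtLow_aRefl (hN : 2 ≤ N) {i : ℕ} (hi : i ∈ Icc 1 (2 * N - 2)) (α : ZMod (2 * N) → K)
    (hα : α i ≠ 0) : wtLow (aRefl (i : ZMod (2 * N)) α) = wtLow α := by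
  rw [mem_Icc] at hi
  have h := prod_aRefl_pow (i : ZMod (2 * N)) α ZMod.val
    (one_ne_zero_zmod hN) (two_ne_zero_zmod hN) hα
  have e1 : ((i : ZMod (2 * N)) + 1).val = i + 1 := by
    rw [← Nat.cast_succ, ZMod.val_natCast_of_lt (by omega)]
  have e2 : ((i : ZMod (2 * N)) - 1).val = i - 1 := by
    rw [val_natCast_sub_one] <;> omega
  rw [e1, e2, ZMod.val_natCast_of_lt (by omega), show i + 1 + (i - 1) = 2 * i by omega] at h
  exact mul_right_cancel₀ (pow_ne_zero _ hα) h

theorem wtLow_aRefl_zero (hN : 2 ≤ N) (α : ZMod (2 * N) → K)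
    (hα : α 0 ≠ 0) : wtLow (aRefl 0 α) = α 0 ^ (2 * N) * wtLow α := by
  have h := prod_aRefl_pow 0 α ZMod.val (one_ne_zero_zmod hN) (two_ne_zero_zmod hN) hα
  rw [zero_add, ZMod.val_one'' (by omega), add_comm 1, val_zero_sub_one, ZMod.val_zero, mul_zero,
    pow_zero, mul_one] at h
  rw [wtLow, h, mul_comm, wtLow]

theorem prod_aRefl (hN : 2 ≤ N) (i : ZMod (2 * N)) (α : ZMod (2 * N) → K) (hα : α i ≠ 0) :
    ∏ j, aRefl i α j = ∏ j, α j := by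
  have h := prod_aRefl_pow i α (fun _ => 1) (one_ne_zero_zmod hN) (two_ne_zero_zmod hN) hα
  simp only [pow_one, mul_one] at h
  exact mul_right_cancel₀ (pow_ne_zero _ hα) h

end weights

section tuples

theorem Tup.ext_of_components {u v : Tup N K} (ha : ∀ j, u.a j = v.a j) (hb : u.b = v.b)
    (hq : u.q = v.q) (hf : ∀ j, u.f j = v.f j) : u = v := by
  cases u; cases v
  congr 1
  · exact funext ha
  · exact funext hf

@[simp] theorem sMap_a (i : ℕ) (v : Tup N K) : (sMap i v).a = aRefl (i : ZMod (2 * N)) v.a := rfl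
@[simp] theorem sMap_b (i : ℕ) (v : Tup N K) : (sMap i v).b = v.b := rfl
@[simp] theorem sMap_q (i : ℕ) (v : Tup N K) : (sMap i v).q = v.q := rfl
theorem sMap_f (i j : ℕ) (v : Tup N K) : (sMap i v).f j =
    if j = i then fstF (v.a i ^ (2 * N)) (v.f i) (v.f (i + 1))
    else if j = i + 1 then sndF (v.a i ^ (2 * N)) (v.f i) (v.f (i + 1)) else v.f j := rfl

@[simp] theorem sMap_f_self (i : ℕ) (v : Tup N K) :
    (sMap i v).f i = fstF (v.a i ^ (2 * N)) (v.f i) (v.f (i + 1)) := by simp [sMap_f]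
@[simp] theorem sMap_f_succ (i : ℕ) (v : Tup N K) :
    (sMap i v).f (i + 1) = sndF (v.a i ^ (2 * N)) (v.f i) (v.f (i + 1)) := by simp [sMap_f]
theorem sMap_f_of_ne {i j : ℕ} (v : Tup N K) (h1 : j ≠ i) (h2 : j ≠ i + 1) :
    (sMap i v).f j = v.f j := by simp [sMap_f, h1, h2]

theorem aRefl_ne_zero {R : Type*} [CommRing R] [DecidableEq R] (i : R) {α : R → K}
    (hα : ∀ j, α j ≠ 0) (j : R) : aRefl i α j ≠ 0 := by
  unfold aRefl
  split_ifs
  · exact inv_ne_zero (hα j)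
  · exact mul_ne_zero (hα i) (hα j)
  · exact hα j

theorem aRefl_self {R : Type*} [CommRing R] [DecidableEq R] (i : R) (α : R → K) :
    aRefl i α i = (α i)⁻¹ := if_pos rfl

theorem aRefl_succ {R : Type*} [CommRing R] [DecidableEq R] (i : R) (α : R → K)
    (h1 : (1 : R) ≠ 0) : aRefl i α (i + 1) = α i * α (i + 1) := by simp [aRefl, h1]

theorem aRefl_pred {R : Type*} [CommRing R] [DecidableEq R] (i : R) (α : R → K)
    (h1 : (1 : R) ≠ 0) : aRefl (i + 1) α i = α (i + 1) * α i := by simp [aRefl, h1]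

theorem aRefl_of_ne {R : Type*} [CommRing R] [DecidableEq R] {i j : R} (α : R → K)
    (h1 : j ≠ i) (h2 : j ≠ i + 1) (h3 : j ≠ i - 1) : aRefl i α j = α j := by
  simp [aRefl, h1, h2, h3]

theorem aRefl_sub_one {R : Type*} [CommRing R] [DecidableEq R] (i j : R) (α : R → K) :
    aRefl i (fun j => α (j - 1)) j = aRefl (i - 1) α (j - 1) := by
  have e1 : j - 1 = i - 1 ↔ j = i := sub_left_inj
  have e2 : j - 1 = i - 1 + 1 ↔ j = i + 1 := by
    constructor <;> intro h <;> linear_combination h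
  have e3 : j - 1 = i - 1 - 1 ↔ j = i - 1 := sub_left_inj
  simp only [aRefl, e1, e2, e3]

theorem aRefl_inv_neg {R : Type*} [CommRing R] [DecidableEq R] (i j : R) (α : R → K) :
    aRefl i (fun j => (α (-j))⁻¹) j = (aRefl (-i) α (-j))⁻¹ := by
  have e1 : -j = -i ↔ j = i := neg_inj
  have e2 : -j = -i + 1 ↔ j = i - 1 := by
    constructor <;> intro h <;> linear_combination -h
  have e3 : -j = -i - 1 ↔ j = i + 1 := by
    constructor <;> intro h <;> linear_combination -h
  simp only [aRefl, e1, e2, e3]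
  split_ifs <;> grind

theorem sMap_sMap {i : ℕ} {v : Tup N K} (h : Nz v)
    (h' : fstF (v.a i ^ (2 * N)) (v.f i) (v.f (i + 1)) ≠ 0) : sMap i (sMap i v) = v := by
  have hi := fstF_invol (pow_ne_zero (2 * N) (h.1 i)) h'
  refine Tup.ext_of_components (fun j => ?_) rfl rfl fun j => ?_
  · simp [aRefl_invol _ _ (h.1 i)]
  · rw [sMap_f, sMap_f_succ, sMap_f_self, sMap_a, aRefl_self, inv_pow, hi.1, hi.2]
    split_ifs with h1 h2
    · rw [h1]
    · rw [h2]
    · exact sMap_f_of_ne v h1 h2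

theorem sMap_comm {i j : ℕ} {v : Tup N K} (hij : (i : ZMod (2 * N)) ≠ j)
    (hij1 : (j : ZMod (2 * N)) ≠ i + 1) (hij2 : (j : ZMod (2 * N)) ≠ i - 1)
    (h : i + 2 ≤ j ∨ j + 2 ≤ i) : sMap i (sMap j v) = sMap j (sMap i v) := by
  have h1 : (sMap j v).a i = v.a i :=
    aRefl_of_ne _ hij (fun h => hij2 (by linear_combination -h))
      (fun h => hij1 (by linear_combination -h))
  have h2 : (sMap i v).a j = v.a j := aRefl_of_ne _ hij.symm hij1 hij2
  have e1 := sMap_f_of_ne (i := j) (j := i) v (by omega) (by omega)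
  have e2 := sMap_f_of_ne (i := j) (j := i + 1) v (by omega) (by omega)
  have e3 := sMap_f_of_ne (i := i) (j := j) v (by omega) (by omega)
  have e4 := sMap_f_of_ne (i := i) (j := j + 1) v (by omega) (by omega)
  refine Tup.ext_of_components (fun l => ?_) rfl rfl fun l => ?_
  · exact congrFun (aRefl_comm _ hij.symm hij1 hij2) l
  · rw [sMap_f i l (sMap j v), sMap_f j l (sMap i v), h1, h2, e1, e2, e3, e4, sMap_f, sMap_f]
    split_ifs <;> first | rfl | omega

theorem sMap_braid (hN : 2 ≤ N) {i : ℕ} {v : Tup N K} (h : Nz v)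
    (h1 : (sMap i v).f i ≠ 0) (h2 : (sMap (i + 1) (sMap i v)).f (i + 1) ≠ 0)
    (h3 : (sMap i (sMap (i + 1) (sMap i v))).f i ≠ 0)
    (h4 : (sMap (i + 1) v).f (i + 1) ≠ 0) (h5 : (sMap i (sMap (i + 1) v)).f i ≠ 0)
    (h6 : (sMap (i + 1) (sMap i (sMap (i + 1) v))).f (i + 1) ≠ 0) :
    sMap i (sMap (i + 1) (sMap i v)) = sMap (i + 1) (sMap i (sMap (i + 1) v)) := by
  have o := one_ne_zero_zmod hN
  have hA := h.1 i
  have hB := h.1 (i + 1)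
  have a1 : (aRefl (i : ZMod (2 * N)) v.a) (i + 1) ^ (2 * N) =
      v.a i ^ (2 * N) * v.a (i + 1) ^ (2 * N) := by
    rw [aRefl_succ _ _ o, mul_pow]
  have a2 : (aRefl (i + 1 : ZMod (2 * N)) v.a) i ^ (2 * N) =
      v.a i ^ (2 * N) * v.a (i + 1) ^ (2 * N) := by
    rw [aRefl_pred _ _ o, mul_pow, mul_comm]
  have a3 : (aRefl (i + 1 : ZMod (2 * N)) (aRefl i v.a)) i = v.a (i + 1) := by
    rw [aRefl_pred _ _ o, aRefl_succ _ _ o, aRefl_self]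
    field_simp
  have a4 : (aRefl (i : ZMod (2 * N)) (aRefl (i + 1) v.a)) (i + 1) = v.a i := by
    rw [aRefl_succ _ _ o, aRefl_pred _ _ o, aRefl_self]
    field_simp
  have f1 : ∀ u : Tup N K, (sMap i u).f (i + 1 + 1) = u.f (i + 1 + 1) := fun u =>
    sMap_f_of_ne u (by omega) (by omega)
  have f2 : ∀ u : Tup N K, (sMap (i + 1) u).f i = u.f i := fun u =>
    sMap_f_of_ne u (by omega) (by omega)
  simp only [sMap_f_self, sMap_f_succ, f1, f2, sMap_a, Nat.cast_add, Nat.cast_one, a1, a2, a3,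
    a4] at h1 h2 h3 h4 h5 h6
  obtain ⟨l1, l2, l3⟩ := braid_left h1 h2 h3
  obtain ⟨r1, r2, r3⟩ := braid_right h4 h5 h6
  refine Tup.ext_of_components (fun l => ?_) rfl rfl fun l => ?_
  · simp only [sMap_a, Nat.cast_add, Nat.cast_one, aRefl_braid _ _ h.1]
  · by_cases c1 : l = i
    · subst c1
      simp only [sMap_f_self, sMap_f_succ, f1, f2, sMap_a, Nat.cast_add, Nat.cast_one, a1, a2, a3,
        l1, r1]
    by_cases c2 : l = i + 1
    · subst c2
      simp only [sMap_f_self, sMap_f_succ, f1, f2, sMap_a, Nat.cast_add, Nat.cast_one, a1, a2, a3,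
        a4, l2, r2]
    by_cases c3 : l = i + 1 + 1
    · subst c3
      simp only [sMap_f_self, sMap_f_succ, f1, f2, sMap_a, Nat.cast_add, Nat.cast_one, a1, a2, a4,
        l3, r3]
    · simp only [sMap_f_of_ne, Ne, c1, c2, c3, not_false_iff]

theorem prod_sMap_f {i : ℕ} {v : Tup N K} {s : Finset ℕ} (hi : i ∈ s) (hi' : i + 1 ∈ s)
    (h : (sMap i v).f i ≠ 0) : ∏ k ∈ s, (sMap i v).f k = ∏ k ∈ s, v.f k := by
  have hi' : i + 1 ∈ s.erase i := mem_erase.2 ⟨by omega, hi'⟩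
  rw [← mul_prod_erase s _ hi, ← mul_prod_erase s _ hi, ← mul_prod_erase _ _ hi',
    ← mul_prod_erase _ _ hi', ← mul_assoc, ← mul_assoc, sMap_f_self, sMap_f_succ]
  rw [sMap_f_self] at h
  rw [fstF_mul_sndF h]
  congr 1
  refine prod_congr rfl fun k hk => sMap_f_of_ne v ?_ ?_
  · exact ne_of_mem_erase (mem_of_mem_erase hk)
  · exact ne_of_mem_erase hk

theorem Nz.sMap_iff {i : ℕ} {v : Tup N K} (h : Nz v) (hi : i ∈ Icc 1 (2 * N - 1)) :
    Nz (sMap i v) ↔ fstF (v.a i ^ (2 * N)) (v.f i) (v.f (i + 1)) ≠ 0 := by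
  rw [mem_Icc] at hi
  constructor
  · intro h'
    have := h'.2.2.2 i (by rw [mem_Icc]; omega)
    rwa [sMap_f_self] at this
  · intro h'
    refine ⟨aRefl_ne_zero _ h.1, h.2.1, h.2.2.1, fun j hj => ?_⟩
    rw [sMap_f]
    split_ifs
    · exact h'
    · obtain ⟨h1, h2⟩ := fstF_ne h'
      exact div_ne_zero (mul_ne_zero (h.2.2.2 _ (by rw [mem_Icc]; omega)) h1) h2
    · exact h.2.2.2 j hj

theorem C_iff [NeZero N] (v : Tup N K) : C v ↔ ∏ j, v.a j = v.q := by
  rw [C, prod_range_natCast]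

theorem C.sMap [NeZero N] (hN : 2 ≤ N) {i : ℕ} {v : Tup N K} (hC : C v) (h : Nz v) :
    C (sMap i v) := by
  rw [C_iff] at hC ⊢
  rw [sMap_a, prod_aRefl hN _ _ (h.1 i), hC, sMap_q]

end tuples

section involution

theorem fstF_inv {A x y : K} (hA : A ≠ 0) : fstF A⁻¹ y x = sndF A x y := by
  rw [(fstF_sndF_eq (D := 1 - A * x * y) (E := A - x * y) hA (by field_simp) (by field_simp)).1,
    sndF]

theorem sndF_inv {A x y : K} (hA : A ≠ 0) : sndF A⁻¹ y x = fstF A x y := by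
  rw [(fstF_sndF_eq (D := 1 - A * x * y) (E := A - x * y) hA (by field_simp) (by field_simp)).2,
    fstF]

theorem fstZ_inv {A T x y : K} (hA : A ≠ 0) : fstZ A⁻¹ (A * T) y x = sndZ A T x y := by
  rw [(fstZ_sndZ_eq (X := x + A * y + A ^ 2 * T) (D := A * x + y + A * T) (Y := x + A * y + T) hA
    (by field_simp; ring) (by field_simp; ring) (by field_simp; ring)).1, sndZ]

theorem sndZ_inv {A T x y : K} (hA : A ≠ 0) : sndZ A⁻¹ (A * T) y x = fstZ A T x y := by
  rw [(fstZ_sndZ_eq (X := x + A * y + A ^ 2 * T) (D := A * x + y + A * T) (Y := x + A * y + T) hA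
    (by field_simp; ring) (by field_simp; ring) (by field_simp; ring)).2, fstZ]

theorem w1_f (v : Tup N K) (j : ℕ) :
    (w1 v).f j = if 1 ≤ j ∧ j ≤ 2 * N then v.f (2 * N - j + 1) else v.f j := rfl

theorem w1_f_of_mem (v : Tup N K) {j : ℕ} (hj : j ∈ Icc 1 (2 * N)) :
    (w1 v).f j = v.f (2 * N - j + 1) := if_pos (mem_Icc.1 hj)

theorem w1_w1 {v : Tup N K} (h : Nz v) : w1 (w1 v) = v := by
  have hq := h.2.2.1
  refine Tup.ext_of_components (fun j => ?_) ?_ (inv_inv _) fun j => ?_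
  · simp [w1]
  · change v.q⁻¹ ^ (2 * N) * (v.q ^ (2 * N) * v.b) = v.b
    rw [← mul_assoc, ← mul_pow, inv_mul_cancel₀ hq, one_pow, one_mul]
  · rw [w1_f]
    split_ifs with hj
    · rw [w1_f_of_mem _ (by rw [mem_Icc]; omega)]
      congr 1; omega
    · rw [w1_f, if_neg hj]

theorem Nz.w1 {v : Tup N K} (h : Nz v) : Nz (w1 v) := by
  refine ⟨fun j => inv_ne_zero (h.1 _), mul_ne_zero (pow_ne_zero _ h.2.2.1) h.2.1,
    inv_ne_zero h.2.2.1, fun j hj => ?_⟩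
  rw [w1_f_of_mem v hj]
  rw [mem_Icc] at hj
  exact h.2.2.2 _ (by rw [mem_Icc]; omega)

theorem C.w1 [NeZero N] {v : Tup N K} (hC : C v) : C (w1 v) := by
  rw [C_iff] at hC ⊢
  change ∏ j, (v.a (-j))⁻¹ = v.q⁻¹
  rw [← hC, Finset.prod_inv_distrib, ← Equiv.prod_comp (Equiv.neg _)]
  simp

theorem natCast_two_mul_sub {i : ℕ} (hi : i ≤ 2 * N) :
    ((2 * N - i : ℕ) : ZMod (2 * N)) = -i := by
  rw [Nat.cast_sub hi, ZMod.natCast_self, zero_sub]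

theorem sMap_w1 {i : ℕ} (hi : i ∈ Icc 1 (2 * N - 1)) {v : Tup N K} (h : Nz v) :
    sMap i (w1 v) = w1 (sMap (2 * N - i) v) := by
  rw [mem_Icc] at hi
  have hc : ((2 * N - i : ℕ) : ZMod (2 * N)) = -i := natCast_two_mul_sub (by omega)
  have hA := pow_ne_zero (2 * N) (h.1 (-i))
  have e1 : (w1 v).f i = v.f (2 * N - i + 1) := w1_f_of_mem _ (by rw [mem_Icc]; omega)
  have e2 : (w1 v).f (i + 1) = v.f (2 * N - i) := by
    rw [w1_f_of_mem _ (by rw [mem_Icc]; omega)]; congr 1; omega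
  have e3 : (w1 v).a i ^ (2 * N) = (v.a (-i) ^ (2 * N))⁻¹ := inv_pow _ _
  refine Tup.ext_of_components (fun j => ?_) rfl rfl fun j => ?_
  · change _ = (aRefl _ v.a (-j))⁻¹
    rw [hc]
    exact aRefl_inv_neg _ _ _
  · rw [sMap_f, e1, e2, e3, fstF_inv hA, sndF_inv hA, w1_f (sMap _ _), sMap_f, sMap_f, hc, w1_f]
    split_ifs <;> first | rfl | omega

/-- The product of the inner `f`-components. -/
def mid (v : Tup N K) : K := ∏ k ∈ Icc 2 (2 * N - 1), v.f k

theorem Nz.mid {v : Tup N K} (h : Nz v) : mid v ≠ 0 := by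
  refine prod_ne_zero_iff.2 fun k hk => h.2.2.2 k ?_
  rw [mem_Icc] at hk ⊢
  omega

theorem mid_w1 (v : Tup N K) : mid (w1 v) = mid v := by
  refine prod_nbij' (fun k => 2 * N - k + 1) (fun k => 2 * N - k + 1) ?_ ?_ ?_ ?_ ?_ <;>
    intro k hk <;> rw [mem_Icc] at hk
  · rw [mem_Icc]; omega
  · rw [mem_Icc]; omega
  · omega
  · omega
  · exact w1_f_of_mem v (by rw [mem_Icc]; omega)

theorem mid_sMap {i : ℕ} (hi : i ∈ Icc 2 (2 * N - 2)) {v : Tup N K} (h : (sMap i v).f i ≠ 0) :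
    mid (sMap i v) = mid v := by
  rw [mem_Icc] at hi
  exact prod_sMap_f (by rw [mem_Icc]; omega) (by rw [mem_Icc]; omega) h

variable [NeZero N]

/-- The coefficient entering the closed form of `s₀`. -/
def tv (v : Tup N K) : K := v.b * wtLow v.a / mid v

theorem tv_w1 {v : Tup N K} (hC : C v) (h : Nz v) : tv (w1 v) = v.a 0 ^ (2 * N) * tv v := by
  rw [C_iff] at hC
  rw [tv, mid_w1, tv, mul_div_assoc', mul_left_comm, ← wtHigh_eq, ← wtLow_inv_neg _ h.1, hC]
  change v.q ^ (2 * N) * v.b * wtLow (fun j => (v.a (-j))⁻¹) / mid v = _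
  congr 1; ring

/-- The closed form of `s₀ = π ∘ s₁ ∘ π⁻¹`. -/
def s0Map (v : Tup N K) : Tup N K where
  a := aRefl 0 v.a
  b := v.b
  q := v.q
  f := fun j => if j = 1 then fstZ (v.a 0 ^ (2 * N)) (tv v) (v.f 1) (v.f (2 * N))
    else if j = 2 * N then sndZ (v.a 0 ^ (2 * N)) (tv v) (v.f 1) (v.f (2 * N)) else v.f j

theorem s0Map_f (v : Tup N K) (j : ℕ) : (s0Map v).f j =
    if j = 1 then fstZ (v.a 0 ^ (2 * N)) (tv v) (v.f 1) (v.f (2 * N))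
    else if j = 2 * N then sndZ (v.a 0 ^ (2 * N)) (tv v) (v.f 1) (v.f (2 * N)) else v.f j := rfl

theorem s0Map_f_one (v : Tup N K) :
    (s0Map v).f 1 = fstZ (v.a 0 ^ (2 * N)) (tv v) (v.f 1) (v.f (2 * N)) := rfl

theorem s0Map_f_last (v : Tup N K) :
    (s0Map v).f (2 * N) = sndZ (v.a 0 ^ (2 * N)) (tv v) (v.f 1) (v.f (2 * N)) := by
  rw [s0Map_f, if_neg (by omega), if_pos rfl]

theorem s0Map_f_of_ne (v : Tup N K) {j : ℕ} (h1 : j ≠ 1) (h2 : j ≠ 2 * N) :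
    (s0Map v).f j = v.f j := by rw [s0Map_f, if_neg h1, if_neg h2]

theorem C.s0Map (hN : 2 ≤ N) {v : Tup N K} (hC : C v) (h : Nz v) : C (s0Map v) := by
  rw [C_iff] at hC ⊢
  exact (prod_aRefl hN _ _ (h.1 0)).trans hC

theorem s0Map_w1 {v : Tup N K} (hC : C v) (h : Nz v) : s0Map (w1 v) = w1 (s0Map v) := by
  have hA := pow_ne_zero (2 * N) (h.1 0)
  have hN : 1 ≤ N := NeZero.one_le
  have e1 : (w1 v).f 1 = v.f (2 * N) := by
    rw [w1_f_of_mem _ (by rw [mem_Icc]; omega)]; congr 1; omega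
  have e2 : (w1 v).f (2 * N) = v.f 1 := by
    rw [w1_f_of_mem _ (by rw [mem_Icc]; omega)]; congr 1; omega
  have e3 : (w1 v).a 0 ^ (2 * N) = (v.a 0 ^ (2 * N))⁻¹ := by
    change (v.a (-0))⁻¹ ^ _ = _
    rw [neg_zero, inv_pow]
  refine Tup.ext_of_components (fun j => ?_) rfl rfl fun j => ?_
  · change _ = (aRefl _ v.a (-j))⁻¹
    rw [← congrArg (aRefl · v.a (-j)) (neg_zero (G := ZMod (2 * N)))]
    exact aRefl_inv_neg _ _ _
  · rw [s0Map_f, e1, e2, e3, tv_w1 hC h, fstZ_inv hA, sndZ_inv hA, w1_f (s0Map _), s0Map_f,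
      s0Map_f, w1_f]
    split_ifs <;> first | rfl | omega

theorem mid_s0Map (v : Tup N K) : mid (s0Map v) = mid v := by
  refine prod_congr rfl fun k hk => s0Map_f_of_ne v ?_ ?_ <;> rw [mem_Icc] at hk <;> omega

theorem tv_s0Map (hN : 2 ≤ N) {v : Tup N K} (h : Nz v) :
    tv (s0Map v) = v.a 0 ^ (2 * N) * tv v := by
  rw [tv, mid_s0Map, tv, mul_div_assoc', mul_left_comm, ← wtLow_aRefl_zero hN _ (h.1 0)]
  rfl

theorem s0Map_s0Map (hN : 2 ≤ N) {v : Tup N K} (h : Nz v) (h' : Nz (s0Map v)) :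
    s0Map (s0Map v) = v := by
  have h1 := h'.2.2.2 1 (by rw [mem_Icc]; omega)
  have h2 := h'.2.2.2 (2 * N) (by rw [mem_Icc]; omega)
  rw [s0Map_f_one] at h1
  rw [s0Map_f_last] at h2
  have hi := fstZ_invol (pow_ne_zero (2 * N) (h.1 0)) h1 h2
  have ha : (s0Map v).a 0 ^ (2 * N) = (v.a 0 ^ (2 * N))⁻¹ := by
    rw [← inv_pow]; exact congrArg (· ^ _) (aRefl_self _ _)
  refine Tup.ext_of_components (fun j => ?_) rfl rfl fun j => ?_
  · exact congrFun (aRefl_invol _ _ (h.1 0)) j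
  · rw [s0Map_f, s0Map_f_one, s0Map_f_last, tv_s0Map hN h, ha, hi.1, hi.2]
    split_ifs with h1 h2
    · rw [h1]
    · rw [h2]
    · exact s0Map_f_of_ne v h1 h2

theorem tv_sMap (hN : 2 ≤ N) {i : ℕ} (hi : i ∈ Icc 2 (2 * N - 2)) {v : Tup N K} (h : Nz v)
    (h' : (sMap i v).f i ≠ 0) : tv (sMap i v) = tv v := by
  rw [tv, mid_sMap hi h', tv, sMap_a, wtLow_aRefl hN _ _ (h.1 i)]
  · rfl
  · rw [mem_Icc] at hi ⊢; omega

theorem s0Map_sMap (hN : 2 ≤ N) {i : ℕ} (hi : i ∈ Icc 2 (2 * N - 2)) {v : Tup N K} (h : Nz v)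
    (h' : (sMap i v).f i ≠ 0) : s0Map (sMap i v) = sMap i (s0Map v) := by
  have ht := tv_sMap hN hi h h'
  rw [mem_Icc] at hi
  have c0 : (i : ZMod (2 * N)) ≠ 0 := natCast_ne_zero_of_lt (by omega) (by omega)
  have c1 : (i : ZMod (2 * N)) ≠ 0 + 1 := fun hc => natCast_ne_zero_of_lt (n := 2 * N)
    (k := i - 1) (by omega) (by omega) (by rw [Nat.cast_sub (by omega), hc]; simp)
  have c2 : (i : ZMod (2 * N)) ≠ 0 - 1 := fun hc => natCast_ne_zero_of_lt (n := 2 * N)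
    (k := i + 1) (by omega) (by omega) (by rw [Nat.cast_add, hc]; simp)
  have a1 : (sMap i v).a 0 = v.a 0 := aRefl_of_ne _ c0.symm
    (fun h => c2 (by linear_combination -h)) (fun h => c1 (by linear_combination -h))
  have a2 : (s0Map v).a i = v.a i := aRefl_of_ne _ c0 c1 c2
  refine Tup.ext_of_components (fun l => ?_) rfl rfl fun l => ?_
  · exact congrFun (aRefl_comm _ c0 c1 c2) l
  · rw [s0Map_f, sMap_f i l (s0Map v), ht, a1, a2, sMap_f_of_ne (j := 1) v (by omega) (by omega),
      sMap_f_of_ne (j := 2 * N) v (by omega) (by omega), s0Map_f_of_ne (j := i) v (by omega)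
      (by omega), s0Map_f_of_ne (j := i + 1) v (by omega) (by omega), s0Map_f, sMap_f]
    split_ifs <;> first | rfl | omega

theorem tv_sMap_one (hN : 2 ≤ N) {v : Tup N K} (h : Nz v) (h' : Nz (sMap 1 v)) :
    tv (sMap 1 v) = tv v * v.f 2 / (sMap 1 v).f 2 := by
  have hw := wtLow_aRefl hN (i := 1) (by rw [mem_Icc]; omega) v.a (h.1 _)
  have hm : ∀ u : Tup N K, mid u = u.f 2 * ∏ k ∈ Icc 3 (2 * N - 1), u.f k := fun u => by
    rw [mid, ← Finset.insert_Icc_add_one_left_eq_Icc (by omega : 2 ≤ 2 * N - 1),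
      prod_insert (by simp)]
    rfl
  have hp : ∏ k ∈ Icc 3 (2 * N - 1), (sMap 1 v).f k = ∏ k ∈ Icc 3 (2 * N - 1), v.f k :=
    prod_congr rfl fun k hk => sMap_f_of_ne v (by rw [mem_Icc] at hk; omega)
      (by rw [mem_Icc] at hk; omega)
  have h2 := h'.2.2.2 2 (by rw [mem_Icc]; omega)
  have hmv := h.mid
  rw [tv, tv, hm, hp, sMap_a, hw, sMap_b]
  rw [hm] at hmv ⊢
  have := left_ne_zero_of_mul hmv
  have := right_ne_zero_of_mul hmv
  field_simp

theorem s0Map_sMap_one_braid (hN : 2 ≤ N) {v : Tup N K} (h : Nz v) (h1 : Nz (s0Map v))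
    (h2 : Nz (sMap 1 (s0Map v))) (h3 : Nz (sMap 1 v)) (h4 : Nz (s0Map (sMap 1 v)))
    (h5 : Nz (sMap 1 (s0Map (sMap 1 v)))) :
    s0Map (sMap 1 (s0Map v)) = sMap 1 (s0Map (sMap 1 v)) := by
  have o := one_ne_zero_zmod hN
  have m1 : 1 ∈ Icc 1 (2 * N) := by rw [mem_Icc]; omega
  have m2 : 2 ∈ Icc 1 (2 * N) := by rw [mem_Icc]; omega
  have m3 : 2 * N ∈ Icc 1 (2 * N) := by rw [mem_Icc]; omega
  have hA := h.1 0
  have hB := h.1 1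
  have s1 : ∀ u : Tup N K, (sMap 1 u).a = aRefl 1 u.a := fun u => by simp
  have a1 : (s0Map v).a 1 = v.a 0 * v.a 1 := by
    have := aRefl_succ 0 v.a o
    rwa [zero_add] at this
  have a2 : (sMap 1 v).a 0 = v.a 0 * v.a 1 := by
    have := aRefl_pred 0 v.a o
    rwa [zero_add, mul_comm (v.a 1), ← s1] at this
  have a3 : (sMap 1 (s0Map v)).a 0 = v.a 1 := by
    have := aRefl_pred 0 (s0Map v).a o
    rw [zero_add, a1] at this
    rw [s1, this]
    change _ * aRefl 0 v.a 0 = _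
    rw [aRefl_self]
    field_simp
  have a4 : (s0Map (sMap 1 v)).a 1 = v.a 0 := by
    have := aRefl_succ 0 (sMap 1 v).a o
    rw [zero_add, a2] at this
    refine this.trans ?_
    rw [s1, aRefl_self]
    field_simp
  have b1 : ∀ u : Tup N K, (s0Map u).f 2 = u.f 2 := fun u => s0Map_f_of_ne u (by omega) (by omega)
  have b2 : ∀ u : Tup N K, (sMap 1 u).f (2 * N) = u.f (2 * N) := fun u =>
    sMap_f_of_ne u (by omega) (by omega)
  have b3 : ∀ u : Tup N K, (sMap 1 u).f 1 = fstF (u.a 1 ^ (2 * N)) (u.f 1) (u.f 2) := fun u => by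
    simp
  have b4 : ∀ u : Tup N K, (sMap 1 u).f 2 = sndF (u.a 1 ^ (2 * N)) (u.f 1) (u.f 2) := fun u => by
    simp
  have hz := h.2.2.2 2 m2
  have t1 := tv_sMap_one hN h h3
  have t2 := tv_sMap_one hN h1 h2
  rw [tv_s0Map hN h, b1, mul_assoc] at t2
  have ht : tv v = tv v * v.f 2 / v.f 2 := by field_simp
  have e1 := s0Map_f_one v
  have e2 := s0Map_f_last v
  have e3 := b3 (s0Map v)
  have e4 := b4 (s0Map v)
  have e5 := s0Map_f_one (sMap 1 (s0Map v))
  have e6 := s0Map_f_last (sMap 1 (s0Map v))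
  have g3 := s0Map_f_one (sMap 1 v)
  have g4 := s0Map_f_last (sMap 1 v)
  have g5 := b3 (s0Map (sMap 1 v))
  have g6 := b4 (s0Map (sMap 1 v))
  rw [ht] at e1 e2
  rw [a1, mul_pow, b1] at e3 e4
  rw [a3, t2, b2] at e5 e6
  rw [a2, mul_pow, t1, b2] at g3 g4
  rw [a4, b1] at g5 g6
  obtain ⟨l1, l2, l3⟩ := braidZ (pow_ne_zero (2 * N) hA) hz e1 e2 e3 e4 e5 e6 (b3 v) (b4 v) g3 g4
    g5 g6 (h1.2.2.2 _ m1) (h1.2.2.2 _ m3) (h2.2.2.2 _ m1) (h3.2.2.2 _ m1) (h4.2.2.2 _ m1)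
    (h4.2.2.2 _ m3) (h5.2.2.2 _ m1)
  refine Tup.ext_of_components (fun l => ?_) rfl rfl fun l => ?_
  · have := congrFun (aRefl_braid 0 v.a h.1) l
    rw [zero_add] at this
    rw [s1]
    change aRefl 0 (sMap 1 (s0Map v)).a l = aRefl 1 (aRefl 0 (sMap 1 v).a) l
    rw [s1, s1]
    exact this
  · by_cases c1 : l = 1
    · rw [c1, l1]
    by_cases c2 : l = 2 * N
    · rw [c2, l2, b2]
    by_cases c3 : l = 2
    · rw [c3, b1, l3]
    · rw [s0Map_f_of_ne _ c1 c2, sMap_f_of_ne _ c1 c3, s0Map_f_of_ne _ c1 c2,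
        sMap_f_of_ne _ c1 c3, s0Map_f_of_ne _ c1 c2, sMap_f_of_ne _ c1 c3]

end involution

section rotation

theorem sndF_eq_fstZ {A T x y h : K} (hx : x ≠ 0) (hy : y ≠ 0) (hh : h = -((T + x) / (x * y))) :
    sndF A h x = fstZ A T x y := by
  have k1 : A - h * x = (x + A * y + T) / y := by rw [hh]; field_simp; ring
  have k2 : 1 - A * h * x = (A * x + y + A * T) / y := by rw [hh]; field_simp; ring
  rw [sndF, fstZ, k1, k2, mul_div_assoc', div_div_div_cancel_right₀ hy]

theorem sndZ_eq_of_fstF {A T x y h : K} (hx : x ≠ 0) (hy : y ≠ 0) (hh : h = -((T + x) / (x * y)))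
    (hf : fstF A h x ≠ 0) : -(A * T / (h * x) + 1 / fstF A h x) = sndZ A T x y := by
  have k1 : A - h * x = (x + A * y + T) / y := by rw [hh]; field_simp; ring
  have k2 : 1 - A * h * x = (A * x + y + A * T) / y := by rw [hh]; field_simp; ring
  obtain ⟨n1, n2⟩ := fstF_ne hf
  have h0 : T + x ≠ 0 := fun e => hf (by simp [hh, e, fstF])
  rw [k1] at n1
  rw [k2] at n2
  have n3 := (div_ne_zero_iff.1 n1).1
  have n4 := (div_ne_zero_iff.1 n2).1
  rw [fstF, sndZ, k1, k2, hh]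
  field_simp
  ring

theorem piMap_f (v : Tup N K) (j : ℕ) : (piMap v).f j =
    if 1 ≤ j ∧ j ≤ 2 * N - 1 then v.f (j + 1) else if j = 2 * N then Pval v else v.f j := rfl

theorem piMap_f_of_mem (v : Tup N K) {j : ℕ} (hj : j ∈ Icc 1 (2 * N - 1)) :
    (piMap v).f j = v.f (j + 1) := if_pos (mem_Icc.1 hj)

theorem piInv_f_of_mem (v : Tup N K) {j : ℕ} (hj : j ∈ Icc 2 (2 * N)) :
    (piInv v).f j = v.f (j - 1) := by
  have := mem_Icc.1 hj
  exact (if_neg (by omega)).trans (if_pos this)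

theorem piInv_f_of_notMem (v : Tup N K) {j : ℕ} (hj : j ∉ Icc 1 (2 * N)) (hj1 : j ≠ 1) :
    (piInv v).f j = v.f j := by
  rw [mem_Icc] at hj
  exact (if_neg hj1).trans (if_neg (by omega))

theorem prod_f_eq_mul_mid (hN : 2 ≤ N) (v : Tup N K) :
    ∏ k ∈ Icc 1 (2 * N - 1), v.f k = v.f 1 * mid v := by
  rw [← Finset.insert_Icc_add_one_left_eq_Icc (by omega : 1 ≤ 2 * N - 1), prod_insert (by simp)]
  rfl

theorem prod_f_eq_mid_mul (hN : 2 ≤ N) (v : Tup N K) :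
    ∏ k ∈ Icc 1 (2 * N), v.f k = v.f 1 * mid v * v.f (2 * N) := by
  rw [← prod_f_eq_mul_mid hN, ← Finset.insert_Icc_sub_one_right_eq_Icc (by omega : 1 ≤ 2 * N),
    prod_insert (by rw [mem_Icc]; omega), mul_comm]

theorem prod_piInv_f (hN : 2 ≤ N) (v : Tup N K) :
    ∏ k ∈ Icc 1 (2 * N), (piInv v).f k = (piInv v).f 1 * (v.f 1 * mid v) := by
  rw [← prod_f_eq_mul_mid hN, ← Finset.insert_Icc_add_one_left_eq_Icc (by omega : 1 ≤ 2 * N),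
    prod_insert (by simp)]
  congr 1
  refine prod_nbij' (fun k => k - 1) (fun k => k + 1) ?_ ?_ ?_ ?_ ?_ <;>
    intro k hk <;> rw [mem_Icc] at hk
  · rw [mem_Icc]; omega
  · rw [mem_Icc]; omega
  · omega
  · omega
  · exact piInv_f_of_mem v (by rw [mem_Icc]; omega)

theorem w1_a_zero_pow (v : Tup N K) : (w1 v).a 0 ^ (2 * N) = (v.a 0 ^ (2 * N))⁻¹ := by
  change (v.a (-0))⁻¹ ^ _ = _
  rw [neg_zero, inv_pow]

variable [NeZero N]

theorem Pval_eq (hN : 2 ≤ N) {v : Tup N K} (hC : C v) (h : Nz v) :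
    Pval v = -(v.b * wtHigh v.a / (∏ k ∈ Icc 1 (2 * N), v.f k) + 1 / v.f 1) := by
  have hE : ∏ k ∈ Icc 1 (2 * N - 2), v.a k ^ (2 * N - k - 1) ≠ 0 :=
    prod_ne_zero_iff.2 fun k _ => pow_ne_zero _ (h.1 k)
  have hp := prod_pow_mul_zero hN v.a
  rw [(C_iff v).1 hC] at hp
  rw [Pval, hp, ← neg_mul, ← mul_neg, mul_assoc, mul_div_mul_left _ _ hE]
  ring

theorem Pval_eq_tv (hN : 2 ≤ N) {v : Tup N K} (hC : C v) (h : Nz v) :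
    Pval v = -((v.a 0 ^ (2 * N) * tv v + v.f (2 * N)) / (v.f 1 * v.f (2 * N))) := by
  have hx := h.2.2.2 1 (by rw [mem_Icc]; omega)
  have hy := h.2.2.2 (2 * N) (by rw [mem_Icc]; omega)
  have hm := h.mid
  rw [Pval_eq hN hC h, prod_f_eq_mid_mul hN, wtHigh_eq, tv]
  field_simp

theorem piInv_f_one (hN : 2 ≤ N) {v : Tup N K} (hC : C v) (h : Nz v) :
    (piInv v).f 1 = -((tv v + v.f 1) / (v.f 1 * v.f (2 * N))) := by
  have hx := h.2.2.2 1 (by rw [mem_Icc]; omega)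
  have hy := h.2.2.2 (2 * N) (by rw [mem_Icc]; omega)
  have hm := h.mid
  have hq := h.2.2.1
  have hE : ∏ k ∈ Icc 1 (2 * N - 2), v.a ((k : ZMod (2 * N)) - 1) ^ (2 * N - k - 1) ≠ 0 :=
    prod_ne_zero_iff.2 fun k _ => pow_ne_zero _ (h.1 _)
  have hp := prod_pow_mul_zero hN fun j => v.a (j - 1)
  have hs : ∏ j : ZMod (2 * N), v.a (j - 1) = v.q := by
    rw [← (C_iff v).1 hC, ← Equiv.prod_comp (Equiv.subRight (1 : ZMod (2 * N))) v.a]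
    rfl
  rw [hs, wtHigh_shift, (C_iff v).1 hC, zero_sub] at hp
  rw [piInv]
  simp only [if_true]
  rw [hp, prod_f_eq_mul_mid hN, tv]
  field_simp

theorem C.piInv {v : Tup N K} (hC : C v) : C (piInv v) := by
  rw [C_iff] at hC ⊢
  refine Eq.trans ?_ hC
  rw [← Equiv.prod_comp (Equiv.subRight (1 : ZMod (2 * N))) v.a]
  rfl

theorem C.piMap {v : Tup N K} (hC : C v) : C (piMap v) := by
  rw [C_iff] at hC ⊢
  refine Eq.trans ?_ hC
  rw [← Equiv.prod_comp (Equiv.addRight (1 : ZMod (2 * N))) v.a]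
  rfl

theorem w1_piMap_w1 (hN : 2 ≤ N) {v : Tup N K} (hC : C v) (h : Nz v) :
    w1 (piMap (w1 v)) = piInv v := by
  have hA := pow_ne_zero (2 * N) (h.1 0)
  have hq := h.2.2.1
  refine Tup.ext_of_components (fun j => ?_) ?_ (inv_inv _) fun j => ?_
  · change ((v.a (-(-j + 1)))⁻¹)⁻¹ = v.a (j - 1)
    rw [inv_inv, neg_add, neg_neg, sub_eq_add_neg]
  · change (v.q⁻¹) ^ (2 * N) * (v.q⁻¹ * (v.q ^ (2 * N) * v.b)) = v.b / v.q
    rw [mul_left_comm, ← mul_assoc (v.q⁻¹ ^ _), ← mul_pow, inv_mul_cancel₀ hq, one_pow, one_mul,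
      inv_mul_eq_div]
  · rw [w1_f]
    split_ifs with hj
    · by_cases hj1 : j = 1
      · rw [hj1, piInv_f_one hN hC h, piMap_f, if_neg (by omega), if_pos (by omega),
          Pval_eq_tv hN hC.w1 h.w1, w1_a_zero_pow, tv_w1 hC h, inv_mul_cancel_left₀ hA,
          w1_f_of_mem (j := 1) _ (by rw [mem_Icc]; omega),
          w1_f_of_mem (j := 2 * N) _ (by rw [mem_Icc]; omega), Nat.sub_self, zero_add,
          Nat.sub_add_cancel (by omega), mul_comm (v.f 1)]
      · rw [piInv_f_of_mem _ (by rw [mem_Icc]; omega),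
          piMap_f_of_mem _ (by rw [mem_Icc]; omega), w1_f_of_mem _ (by rw [mem_Icc]; omega)]
        congr 1; omega
    · rw [piInv_f_of_notMem _ (by rwa [mem_Icc]) (by omega), piMap_f, if_neg (by omega),
        if_neg (by omega), w1_f, if_neg hj]

theorem piMap_piInv (hN : 2 ≤ N) {v : Tup N K} (hC : C v) (h : Nz v) (h' : Nz (piInv v)) :
    piMap (piInv v) = v := by
  have hx := h.2.2.2 1 (by rw [mem_Icc]; omega)
  have hy := h.2.2.2 (2 * N) (by rw [mem_Icc]; omega)
  have hm := h.mid
  have hq := h.2.2.1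
  refine Tup.ext_of_components (fun j => ?_) (mul_div_cancel₀ _ hq) rfl fun j => ?_
  · exact congrArg v.a (add_sub_cancel_right _ _)
  · rw [piMap_f]
    split_ifs with h1 h2
    · rw [piInv_f_of_mem _ (by rw [mem_Icc]; omega), Nat.add_sub_cancel]
    · have hh := h'.2.2.2 1 (by rw [mem_Icc]; omega)
      have hw : wtHigh (piInv v).a = v.q * wtLow v.a := by
        rw [← (C_iff v).1 hC, ← wtHigh_shift]
        rfl
      rw [h2, Pval_eq hN hC.piInv h', hw, prod_piInv_f hN]
      rw [piInv_f_one hN hC h] at hh ⊢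
      have ht : tv v + v.f 1 ≠ 0 := fun e => hh (by simp [e])
      change -(v.b / v.q * (v.q * wtLow v.a) / _ + _) = _
      have hT : v.b * wtLow v.a = tv v * mid v := by rw [tv]; field_simp
      rw [div_mul_eq_mul_div, mul_left_comm, mul_div_cancel_left₀ _ hq, hT]
      field_simp
      ring
    · by_cases hj : j = 1
      · omega
      · exact piInv_f_of_notMem _ (by rw [mem_Icc]; omega) hj

theorem piInv_piMap (hN : 2 ≤ N) {v : Tup N K} (hC : C v) (h : Nz v) (h' : Nz (piMap v)) :
    piInv (piMap v) = v := by
  have e : piInv (w1 v) = w1 (piMap v) := by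
    rw [← w1_piMap_w1 hN hC.w1 h.w1, w1_w1 h]
  have e2 := piMap_piInv hN hC.w1 h.w1 (e ▸ h'.w1)
  rw [← w1_piMap_w1 hN hC.piMap h', ← e, e2, w1_w1 h]

theorem piMap_sMap (hN : 2 ≤ N) {k : ℕ} (hk : k ∈ Icc 2 (2 * N - 1)) {v : Tup N K} (hC : C v)
    (h : Nz v) (h' : Nz (sMap k v)) : piMap (sMap k v) = sMap (k - 1) (piMap v) := by
  have hw := wtHigh_aRefl hN hk v.a (h.1 k)
  rw [mem_Icc] at hk
  have hc : ((k - 1 : ℕ) : ZMod (2 * N)) = k - 1 := by rw [Nat.cast_sub (by omega), Nat.cast_one]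
  have ha : (piMap v).a ((k - 1 : ℕ) : ZMod (2 * N)) = v.a k := by
    rw [hc]; exact congrArg v.a (sub_add_cancel _ _)
  have hP : Pval (sMap k v) = Pval v := by
    rw [Pval_eq hN (hC.sMap hN h) h', Pval_eq hN hC h, sMap_a, hw, prod_sMap_f
      (by rw [mem_Icc]; omega) (by rw [mem_Icc]; omega) (h'.2.2.2 k (by rw [mem_Icc]; omega)),
      sMap_f_of_ne (j := 1) _ (by omega) (by omega), sMap_b]
  refine Tup.ext_of_components (fun j => ?_) rfl rfl fun j => ?_
  · have := aRefl_sub_one (k : ZMod (2 * N)) (j + 1) fun j => v.a (j + 1)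
    simp only [sub_add_cancel, add_sub_cancel_right] at this
    rw [sMap_a, hc]
    exact this
  · rw [piMap_f, hP, sMap_f, sMap_f _ _ (piMap v), ha, sMap_f,
      piMap_f_of_mem (j := k - 1) _ (by rw [mem_Icc]; omega), Nat.sub_add_cancel (by omega),
      piMap_f_of_mem (j := k) _ (by rw [mem_Icc]; omega), piMap_f]
    split_ifs <;> first | rfl | omega

theorem piMap_sMap_one_piInv (hN : 2 ≤ N) {v : Tup N K} (hC : C v) (h : Nz v)
    (h' : Nz (piInv v)) (h'' : Nz (sMap 1 (piInv v))) :
    piMap (sMap 1 (piInv v)) = s0Map v := by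
  have m1 : 1 ∈ Icc 1 (2 * N) := by rw [mem_Icc]; omega
  have hx := h.2.2.2 1 m1
  have hy := h.2.2.2 (2 * N) (by rw [mem_Icc]; omega)
  have hm := h.mid
  have hq := h.2.2.1
  have s1 : (sMap 1 (piInv v)).a = aRefl 1 (piInv v).a := by simp
  have a1 : (piInv v).a 1 = v.a 0 := congrArg v.a (sub_self _)
  have f2 : (piInv v).f 2 = v.f 1 := piInv_f_of_mem v (by rw [mem_Icc]; omega)
  have hw : wtHigh (sMap 1 (piInv v)).a = v.q * wtLow v.a * v.a 0 ^ (2 * N) := by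
    rw [s1, wtHigh_aRefl_one hN _ (h'.1 1), ← (C_iff v).1 hC, ← wtHigh_shift, a1]
    rfl
  have hh := h'.2.2.2 1 m1
  have e1 : (sMap 1 (piInv v)).f 1 = fstF (v.a 0 ^ (2 * N)) ((piInv v).f 1) (v.f 1) := by
    rw [← a1, ← f2]; simp
  have e2 : (sMap 1 (piInv v)).f 2 = sndF (v.a 0 ^ (2 * N)) ((piInv v).f 1) (v.f 1) := by
    rw [← a1, ← f2]; simp
  have hf := h''.2.2.2 1 m1
  have hP := prod_sMap_f (i := 1) (v := piInv v) m1 (by rw [mem_Icc]; omega) hf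
  have hPv := Pval_eq hN (hC.piInv.sMap hN h') h''
  rw [hw, hP, prod_piInv_f hN, e1] at hPv
  rw [e1] at hf
  have hv := piInv_f_one hN hC h
  have hT : v.b * wtLow v.a = tv v * mid v := by rw [tv]; field_simp
  refine Tup.ext_of_components (fun j => ?_) (mul_div_cancel₀ _ hq) rfl fun j => ?_
  · have := aRefl_sub_one (1 : ZMod (2 * N)) (j + 1) v.a
    rw [sub_self, add_sub_cancel_right] at this
    change (sMap 1 (piInv v)).a (j + 1) = _
    rw [s1]
    exact this
  · by_cases j1 : j = 1
    · rw [j1, piMap_f_of_mem _ (by rw [mem_Icc]; omega), s0Map_f_one]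
      exact e2.trans (sndF_eq_fstZ hx hy hv)
    by_cases j2 : j = 2 * N
    · rw [j2, piMap_f, if_neg (by omega), if_pos rfl, s0Map_f_last, hPv,
        ← sndZ_eq_of_fstF hx hy hv hf]
      change -(v.b / v.q * _ / _ + _) = _
      rw [← mul_assoc (v.b / v.q), div_mul_eq_mul_div, mul_left_comm, mul_div_cancel_left₀ _ hq, hT]
      congr 2
      field_simp
    rw [s0Map_f_of_ne _ j1 j2, piMap_f, if_neg j2]
    split_ifs
    · rw [sMap_f_of_ne _ (by omega) (by omega), piInv_f_of_mem _ (by rw [mem_Icc]; omega),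
        Nat.add_sub_cancel]
    · rw [sMap_f_of_ne _ (by omega) (by omega), piInv_f_of_notMem _ (by rw [mem_Icc]; omega) j1]

end rotation

section family

theorem okChain.nz : ∀ {l : List (Tup N K → Tup N K)} {v : Tup N K}, okChain l v → Nz v
  | [], _, h => h
  | _ :: _, _, h => h.1

theorem okChain_append : ∀ {l m : List (Tup N K → Tup N K)} {v : Tup N K},
    okChain (l ++ m) v → okChain l v ∧ okChain m (apChain l v)
  | [], _, _, h => ⟨h.nz, h⟩
  | _ :: _, _, _, h => ⟨⟨h.1, (okChain_append h.2).1⟩, (okChain_append h.2).2⟩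

variable [NeZero N]

theorem piMap_piMap_sMap_one (hN : 2 ≤ N) {v : Tup N K} (hC : C v) (h : Nz v) (h1 : Nz (piInv v))
    (h2 : Nz (piInv (piInv v))) (h3 : Nz (sMap 1 (piInv (piInv v))))
    (h4 : Nz (piMap (sMap 1 (piInv (piInv v)))))
    (h5 : Nz (piMap (piMap (sMap 1 (piInv (piInv v)))))) (h6 : Nz (sMap (2 * N - 1) v)) :
    piMap (piMap (sMap 1 (piInv (piInv v)))) = sMap (2 * N - 1) v := by
  have hw : w1 v = piInv (w1 (piInv v)) := by
    rw [← w1_piMap_w1 hN hC.piInv.w1 h1.w1, w1_w1 h1, piMap_piInv hN hC h h1]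
  have hs : sMap 1 (w1 v) = w1 (sMap (2 * N - 1) v) := sMap_w1 (by rw [mem_Icc]; omega) h
  rw [piMap_sMap_one_piInv hN hC.piInv h1 h2 h3] at h4 h5 ⊢
  have hc := piMap_sMap_one_piInv hN hC.piInv.w1 h1.w1 (hw ▸ h.w1) (by rw [← hw, hs]; exact h6.w1)
  rw [← hw, hs, s0Map_w1 hC.piInv h1] at hc
  have hC' := hC.piInv.s0Map hN h1
  rw [← w1_w1 h5, ← w1_w1 h6]
  congr 1
  have e := piInv_piMap hN (v := w1 (sMap (2 * N - 1) v)) (hC.sMap hN h).w1 h6.w1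
    (by rw [hc]; exact h4.w1)
  rw [← e, hc, ← w1_piMap_w1 hN hC'.w1 h4.w1, w1_w1 h4]

/-- The closed form of the family `sFam`. -/
def sW (i : ZMod (2 * N)) (v : Tup N K) : Tup N K := if i = 0 then s0Map v else sMap i.val v

theorem sW_zero (v : Tup N K) : sW 0 v = s0Map v := if_pos rfl

theorem sW_of_ne {i : ZMod (2 * N)} (hi : i ≠ 0) (v : Tup N K) : sW i v = sMap i.val v := if_neg hi

theorem sW_one (hN : 2 ≤ N) (v : Tup N K) : sW 1 v = sMap 1 v := by
  rw [sW_of_ne (one_ne_zero_zmod hN), ZMod.val_one'' (by omega)]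

theorem val_mem_Icc {i : ZMod (2 * N)} (hi : i ≠ 0) : i.val ∈ Icc 1 (2 * N - 1) := by
  have h1 := ZMod.val_lt i
  have h2 : i.val ≠ 0 := by simpa using hi
  rw [mem_Icc]
  omega

theorem C.sW (hN : 2 ≤ N) (i : ZMod (2 * N)) {v : Tup N K} (hC : C v) (h : Nz v) :
    C (sW i v) := by
  unfold WeylA2Nm1A1.sW
  split_ifs
  · exact hC.s0Map hN h
  · exact hC.sMap hN h

theorem sFam_eq_sW (hN : 2 ≤ N) {i : ZMod (2 * N)} {v : Tup N K} (hC : C v)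
    (h : okChain (sL i) v) : sFam i v = sW i v := by
  by_cases hi : i = 0
  · subst hi
    simp only [sL, if_true, okChain] at h
    rw [sFam, sL, if_pos rfl, sW_zero]
    exact piMap_sMap_one_piInv hN hC h.1 h.2.1 h.2.2.1
  · rw [sFam, sL, if_neg hi, sW_of_ne hi]
    rfl

theorem okChain_sL_append (hN : 2 ≤ N) {i : ZMod (2 * N)} {l : List (Tup N K → Tup N K)}
    {v : Tup N K} (hC : C v) (h : okChain (sL i ++ l) v) :
    sFam i v = sW i v ∧ Nz v ∧ C (sW i v) ∧ okChain l (sW i v) := by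
  obtain ⟨h1, h2⟩ := okChain_append h
  have e := sFam_eq_sW hN hC h1
  exact ⟨e, h1.nz, hC.sW hN i h1.nz, e ▸ h2⟩

theorem okChain_sL (hN : 2 ≤ N) {i : ZMod (2 * N)} {v : Tup N K} (hC : C v)
    (h : okChain (sL i) v) : sFam i v = sW i v ∧ Nz v ∧ Nz (sW i v) := by
  rw [← List.append_nil (sL i)] at h
  obtain ⟨h1, h2, -, h3⟩ := okChain_sL_append hN hC h
  exact ⟨h1, h2, h3⟩

theorem sW_w1 (i : ZMod (2 * N)) {v : Tup N K} (hC : C v) (h : Nz v) :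
    sW i (w1 v) = w1 (sW (-i) v) := by
  by_cases hi : i = 0
  · rw [hi, neg_zero, sW_zero, sW_zero, s0Map_w1 hC h]
  · rw [sW_of_ne hi, sW_of_ne (neg_ne_zero.2 hi), sMap_w1 (val_mem_Icc hi) h, ZMod.neg_val,
      if_neg hi]

theorem sW_sW (hN : 2 ≤ N) (i : ZMod (2 * N)) {v : Tup N K} (h : Nz v) (h' : Nz (sW i v)) :
    sW i (sW i v) = v := by
  by_cases hi : i = 0
  · rw [hi, sW_zero] at h' ⊢
    rw [sW_zero, s0Map_s0Map hN h h']
  · rw [sW_of_ne hi] at h' ⊢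
    rw [sW_of_ne hi, sMap_sMap h ((h.sMap_iff (val_mem_Icc hi)).1 h')]

theorem sW_braid (hN : 2 ≤ N) (i : ZMod (2 * N)) {v : Tup N K} (hC : C v) (h : Nz v)
    (h1 : Nz (sW i v)) (h2 : Nz (sW (i + 1) (sW i v))) (h3 : Nz (sW i (sW (i + 1) (sW i v))))
    (h4 : Nz (sW (i + 1) v)) (h5 : Nz (sW i (sW (i + 1) v)))
    (h6 : Nz (sW (i + 1) (sW i (sW (i + 1) v)))) :
    sW i (sW (i + 1) (sW i v)) = sW (i + 1) (sW i (sW (i + 1) v)) := by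
  by_cases hi : i = 0
  · subst hi
    simp only [zero_add, sW_zero, sW_one hN] at *
    exact s0Map_sMap_one_braid hN h h1 h2 h4 h5 h6
  by_cases hi' : i + 1 = 0
  · obtain rfl : i = -1 := eq_neg_of_add_eq_zero_left hi'
    rw [neg_add_cancel] at *
    have c1 := hC.sW hN (-1) h
    have c2 := c1.sW hN 0 h1
    have c3 := hC.sW hN 0 h
    have c4 := c3.sW hN (-1) h4
    have k1 : sW 0 (w1 v) = w1 (sW 0 v) := by rw [sW_w1 0 hC h, neg_zero]
    have k2 : sW 1 (sW 0 (w1 v)) = w1 (sW (-1) (sW 0 v)) := by rw [k1, sW_w1 1 c3 h4]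
    have k3 : sW 0 (sW 1 (sW 0 (w1 v))) = w1 (sW 0 (sW (-1) (sW 0 v))) := by
      rw [k2, sW_w1 0 c4 h5, neg_zero]
    have k4 : sW 1 (w1 v) = w1 (sW (-1) v) := sW_w1 1 hC h
    have k5 : sW 0 (sW 1 (w1 v)) = w1 (sW 0 (sW (-1) v)) := by rw [k4, sW_w1 0 c1 h1, neg_zero]
    have k6 : sW 1 (sW 0 (sW 1 (w1 v))) = w1 (sW (-1) (sW 0 (sW (-1) v))) := by
      rw [k5, sW_w1 1 c2 h2]
    have b := s0Map_sMap_one_braid hN h.w1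
    simp only [← sW_zero, ← sW_one hN] at b
    rw [k3, k2, k1, k6, k5, k4] at b
    have e := b h4.w1 h5.w1 h1.w1 h2.w1 h3.w1
    rw [← w1_w1 h3, ← e, w1_w1 h6]
  · have hv : (i + 1).val = i.val + 1 := by
      rw [← val_sub_one (i + 1) hi', add_sub_cancel_right]
    have m1 := mem_Icc.1 (val_mem_Icc hi)
    have m2 := mem_Icc.1 (val_mem_Icc hi')
    simp only [sW_of_ne hi, sW_of_ne hi', hv] at *
    refine sMap_braid hN h (h1.2.2.2 _ ?_) (h2.2.2.2 _ ?_) (h3.2.2.2 _ ?_) (h4.2.2.2 _ ?_)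
      (h5.2.2.2 _ ?_) (h6.2.2.2 _ ?_) <;> rw [mem_Icc] <;> omega

theorem s0Map_sW (hN : 2 ≤ N) {i : ZMod (2 * N)} (h0 : i ≠ 0) (h1 : i ≠ 1) (h2 : i ≠ -1)
    {v : Tup N K} (h : Nz v) (h' : Nz (sW i v)) : s0Map (sW i v) = sW i (s0Map v) := by
  have m := mem_Icc.1 (val_mem_Icc h0)
  have k1 : i.val ≠ 1 := fun e => h1 (by rw [← ZMod.natCast_zmod_val i, e, Nat.cast_one])
  have k2 : i.val ≠ 2 * N - 1 := fun e => h2 (by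
    rw [← ZMod.natCast_zmod_val i, e, natCast_two_mul_sub (by omega), Nat.cast_one])
  rw [sW_of_ne h0] at h' ⊢
  rw [sW_of_ne h0]
  exact s0Map_sMap hN (by rw [mem_Icc]; omega) h (h'.2.2.2 _ (by rw [mem_Icc]; omega))

theorem sW_comm (hN : 2 ≤ N) {i j : ZMod (2 * N)} (hij : j ≠ i) (hij1 : j ≠ i + 1)
    (hij2 : j ≠ i - 1) {v : Tup N K} (h : Nz v) (h1 : Nz (sW i v)) (h2 : Nz (sW j v)) :
    sW i (sW j v) = sW j (sW i v) := by
  by_cases hi : i = 0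
  · subst hi
    rw [zero_add] at hij1
    rw [zero_sub] at hij2
    rw [sW_zero, sW_zero, s0Map_sW hN hij hij1 hij2 h h2]
  by_cases hj : j = 0
  · subst hj
    rw [sW_zero, sW_zero, s0Map_sW hN hi (fun e => hij2 (by rw [e, sub_self]))
      (fun e => hij1 (by rw [e, neg_add_cancel])) h h1]
  have ci := ZMod.natCast_zmod_val i
  have cj := ZMod.natCast_zmod_val j
  have k1 : j.val ≠ i.val := fun e => hij (by rw [← ci, ← cj, e])
  have k2 : j.val ≠ i.val + 1 := fun e => hij1 (by rw [← ci, ← cj, e, Nat.cast_add, Nat.cast_one])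
  have k3 : i.val ≠ j.val + 1 := fun e => hij2 (by
    rw [← ci, ← cj, e, Nat.cast_add, Nat.cast_one, add_sub_cancel_right])
  simp only [sW_of_ne hi, sW_of_ne hj]
  exact sMap_comm (by rw [ci, cj]; exact hij.symm) (by rwa [ci, cj]) (by rwa [ci, cj]) (by omega)

end family

/-- The relations of the extended affine Weyl group of type `(A_{2N−1} ⋊ A₁)⁽¹⁾` for the
birational representation coming from the `(1,…,1)`-periodic reduction with `n = 2N`:
each relation holds at every tuple (subject to `a₀a₁···a_{2N−1} = q`) at which all rational
expressions arising in the indicated composites are defined and nonzero. -/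
theorem weyl_relations_A2Nm1_A1 (hN : 2 ≤ N) :
    -- (1)
    (∀ i ∈ Icc 1 (2 * N - 1), ∀ v : Tup N K, C v →
      okChain [sMap i, sMap i] v → sMap i (sMap i v) = v) ∧
    -- (2)
    (∀ i ∈ Icc 1 (2 * N - 2), ∀ v : Tup N K, C v →
      okChain [sMap i, sMap (i + 1), sMap i] v →
      okChain [sMap (i + 1), sMap i, sMap (i + 1)] v →
      sMap i (sMap (i + 1) (sMap i v)) = sMap (i + 1) (sMap i (sMap (i + 1) v))) ∧
    -- (3)
    (∀ i ∈ Icc 1 (2 * N - 1), ∀ j ∈ Icc 1 (2 * N - 1), (i + 2 ≤ j ∨ j + 2 ≤ i) →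
      ∀ v : Tup N K, C v → okChain [sMap j, sMap i] v → okChain [sMap i, sMap j] v →
      sMap i (sMap j v) = sMap j (sMap i v)) ∧
    -- (4)
    (∀ v : Tup N K, C v → okChain [w1, w1] v → w1 (w1 v) = v) ∧
    -- (5)
    (∀ k ∈ Icc 1 (2 * N - 1), ∀ v : Tup N K, C v →
      okChain [w1, sMap k, w1] v → okChain [sMap (2 * N - k)] v →
      w1 (sMap k (w1 v)) = sMap (2 * N - k) v) ∧
    -- (6)
    (∀ k ∈ Icc 2 (2 * N - 1), ∀ v : Tup N K, C v →
      okChain [piInv, sMap k, piMap] v → okChain [sMap (k - 1)] v →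
      piMap (sMap k (piInv v)) = sMap (k - 1) v) ∧
    (∀ v : Tup N K, C v →
      okChain [piInv, piInv, sMap 1, piMap, piMap] v → okChain [sMap (2 * N - 1)] v →
      piMap (piMap (sMap 1 (piInv (piInv v)))) = sMap (2 * N - 1) v) ∧
    -- (7)
    (∀ v : Tup N K, C v → okChain [w1, piMap, w1, piMap] v →
      piMap (w1 (piMap (w1 v))) = v) ∧
    -- (8): the relations (1), (2), (3) and (5) with indices read modulo 2N
    (∀ i : ZMod (2 * N), ∀ v : Tup N K, C v → okChain (sL i ++ sL i) v →
      sFam i (sFam i v) = v) ∧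
    (∀ i : ZMod (2 * N), ∀ v : Tup N K, C v →
      okChain (sL i ++ sL (i + 1) ++ sL i) v →
      okChain (sL (i + 1) ++ sL i ++ sL (i + 1)) v →
      sFam i (sFam (i + 1) (sFam i v)) = sFam (i + 1) (sFam i (sFam (i + 1) v))) ∧
    (∀ i j : ZMod (2 * N), j ≠ i → j ≠ i + 1 → j ≠ i - 1 →
      ∀ v : Tup N K, C v → okChain (sL j ++ sL i) v → okChain (sL i ++ sL j) v →
      sFam i (sFam j v) = sFam j (sFam i v)) ∧
    (∀ k : ZMod (2 * N), ∀ v : Tup N K, C v →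
      okChain ([w1] ++ sL k ++ [w1]) v → okChain (sL (-k)) v →
      w1 (sFam k (w1 v)) = sFam (-k) v) := by
  have : NeZero N := ⟨by omega⟩
  refine ⟨?_, ?_, ?_, ?_, ?_, ?_, ?_, ?_, ?_, ?_, ?_, ?_⟩
  · intro i hi v _ h
    exact sMap_sMap h.1 ((h.1.sMap_iff hi).1 h.2.1)
  · intro i hi v _ h h'
    simp only [okChain] at h h'
    obtain ⟨h0, h1, h2, h3⟩ := h
    obtain ⟨-, h4, h5, h6⟩ := h'
    rw [mem_Icc] at hi
    refine sMap_braid hN h0 (h1.2.2.2 _ ?_) (h2.2.2.2 _ ?_) (h3.2.2.2 _ ?_) (h4.2.2.2 _ ?_)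
      (h5.2.2.2 _ ?_) (h6.2.2.2 _ ?_) <;> rw [mem_Icc] <;> omega
  · intro i hi j hj hij v _ _ _
    rw [mem_Icc] at hi hj
    have d {k l : ℕ} (hk : k ≤ 2 * N) (hl : l ≤ 2 * N) (h1 : 1 ≤ k) (h2 : 1 ≤ l) (hkl : k ≠ l) :
        (k : ZMod (2 * N)) ≠ l := fun e => hkl (by
      have h := val_natCast_sub_one h1 hk
      rw [e, val_natCast_sub_one h2 hl] at h
      omega)
    refine sMap_comm (d ?_ ?_ ?_ ?_ ?_) ?_ ?_ hij
    any_goals omega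
    · rw [← Nat.cast_add_one]
      apply d <;> omega
    · intro e
      refine d (k := j + 1) (l := i) ?_ ?_ ?_ ?_ ?_ (by rw [Nat.cast_add_one, e, sub_add_cancel])
      all_goals omega
  · intro v _ h
    exact w1_w1 h.1
  · intro k hk v _ h h'
    rw [sMap_w1 hk h.1, w1_w1 h'.2]
  · intro k hk v hC h h'
    simp only [okChain] at h
    rw [piMap_sMap hN hk hC.piInv h.2.1 h.2.2.1, piMap_piInv hN hC h.1 h.2.1]
  · intro v hC h h'
    simp only [okChain] at h
    obtain ⟨h0, h1, h2, h3, h4, h5⟩ := h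
    exact piMap_piMap_sMap_one hN hC h0 h1 h2 h3 h4 h5 h'.2
  · intro v hC h
    simp only [okChain] at h
    have e := w1_piMap_w1 hN hC h.1
    rw [e] at h ⊢
    exact piMap_piInv hN hC h.1 h.2.2.2.1
  · intro i v hC h
    obtain ⟨e, h0, hC', h'⟩ := okChain_sL_append hN hC h
    rw [e, (okChain_sL hN hC' h').1, sW_sW hN i h0 h'.nz]
  · intro i v hC h h'
    rw [List.append_assoc] at h h'
    obtain ⟨e1, h0, c1, h⟩ := okChain_sL_append hN hC h
    obtain ⟨e2, h1, c2, h⟩ := okChain_sL_append hN c1 h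
    obtain ⟨e3, h2, h3⟩ := okChain_sL hN c2 h
    obtain ⟨e4, -, c4, h'⟩ := okChain_sL_append hN hC h'
    obtain ⟨e5, h4, c5, h'⟩ := okChain_sL_append hN c4 h'
    obtain ⟨e6, h5, h6⟩ := okChain_sL hN c5 h'
    rw [e1, e2, e3, e4, e5, e6, sW_braid hN i hC h0 h1 h2 h3 h4 h5 h6]
  · intro i j hij hij1 hij2 v hC h h'
    obtain ⟨e1, h0, c1, h⟩ := okChain_sL_append hN hC h
    obtain ⟨e2, -, c2, h'⟩ := okChain_sL_append hN hC h'
    rw [e1, (okChain_sL hN c1 h).1, e2, (okChain_sL hN c2 h').1,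
      sW_comm hN hij hij1 hij2 h0 h'.nz h.nz]
  · intro k v hC h h'
    obtain ⟨e, -, h0⟩ := okChain_sL hN hC h'
    rw [List.append_assoc] at h
    rw [(okChain_sL_append hN hC.w1 h.2).1, sW_w1 k hC h'.nz, w1_w1 h0, e]

end WeylA2Nm1A1
end

section
/- Fix an integer N ≥ 2 and let K be a field. Let π be the map on tuples (a0,…,a_{2N−1}, b, q, f1,…,f_{2N}) given by π(a0,…,a_{2N−1}, b, q, f1,…,f_{2N}) = (a1,…,a_{2N−1}, a0, q·b, q, f2,…,f_{2N}, −q^{2N−1}·a0·b/[(∏_{k=1}^{2N−2} a_k^{2N−k−1})·(∏_{k=1}^{2N} f_k)] − 1/f1). Let u = (a0,…,a_{2N−1}, b, q, g1,…,g_{2N}) have all entries nonzero with a0·a1···a_{2N−1} = q, and suppose π can be applied 2N times to u with all intermediate entries defined and nonzero; write π^{2N}(u) = (a0,…,a_{2N−1}, q^{2N}·b, q, f1,…,f_{2N}). Then g_i + 1/f_i = a_i^{−2N}·(f_{i+1} + 1/g_{i+1}) for all i = 1,…,2N−1, and g_{2N} + 1/f_{2N} = −(∏_{k=1}^{2N−1}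 a_k^k)·(q^{2N}·b)/∏_{k=1}^{2N} f_k. -/
open Finset

namespace QP2NA6

/-- A tuple `(a₀, …, a_{2N−1}, b, q, f₁, …, f_{2N})`: the `a`-components are indexed
cyclically by `ZMod (2N)` and the `f`-components by the natural numbers `1, …, 2N`. -/
structure Tup (N : ℕ) (K : Type*) where
  a : ZMod (2 * N) → K
  b : K
  q : K
  f : ℕ → K

variable {N : ℕ} {K : Type*} [Field K]

/-- All entries of the tuple are nonzero. -/
def Nz (v : Tup N K) : Prop :=
  (∀ j : ZMod (2 * N), v.a j ≠ 0) ∧ v.b ≠ 0 ∧ v.q ≠ 0 ∧ ∀ j ∈ Icc 1 (2 * N), v.f j ≠ 0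

/-- The last `f`-component of `π`. -/
def Pval (v : Tup N K) : K :=
  -(v.q ^ (2 * N - 1) * v.a 0 * v.b)
      / ((∏ k ∈ Icc 1 (2 * N - 2), v.a k ^ (2 * N - k - 1)) * ∏ k ∈ Icc 1 (2 * N), v.f k)
    - 1 / v.f 1

/-- The map `π`. -/
def piMap (v : Tup N K) : Tup N K where
  a := fun j => v.a (j + 1)
  b := v.q * v.b
  q := v.q
  f := fun j =>
    if 1 ≤ j ∧ j ≤ 2 * N - 1 then v.f (j + 1) else if j = 2 * N then Pval v else v.f j

/-- Shifting the base of a weighted product of consecutive terms. -/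
lemma prod_pow_shift (s : ℕ → K) (m : ℕ) :
    (∏ k ∈ range m, s (k + 1) ^ (m - k)) * s 0 ^ m
      = (∏ k ∈ range m, s k ^ (m - k)) * ∏ k ∈ range m, s (k + 1) := by
  have h1 : ∏ k ∈ range (m + 1), s k ^ (m - k) = ∏ k ∈ range m, s k ^ (m - k) := by
    simp [prod_range_succ]
  rw [← h1, prod_range_succ', mul_right_comm, ← prod_mul_distrib]
  congr 1
  refine prod_congr rfl fun k hk => ?_
  rw [← pow_succ]
  congr 1
  have := mem_range.1 hk
  omega

/-- A product over one full period does not depend on the starting point. -/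
lemma prod_period {n : ℕ} (a : ZMod n → K) (ha : ∀ j, a j ≠ 0) (c : ℕ) :
    ∏ k ∈ range n, a ((c + k : ℕ) : ZMod n) = ∏ k ∈ range n, a k := by
  induction c with
  | zero => simp
  | succ c ih =>
    rw [← ih]
    have h := (prod_range_succ (fun k => a ((c + k : ℕ) : ZMod n)) n).symm.trans
      (prod_range_succ' (fun k => a ((c + k : ℕ) : ZMod n)) n)
    simp only [Nat.cast_add, CharP.cast_eq_zero, add_zero] at h ⊢
    refine mul_right_cancel₀ (ha c) (Eq.trans ?_ h.symm)
    congr 1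
    refine prod_congr rfl fun k _ => congrArg a (by ring)

/-- The weight in the denominator of `Pval`, with the parameters shifted by `c`. -/
def weight {n : ℕ} (a : ZMod n → K) (m c : ℕ) : K :=
  ∏ k ∈ range m, a ((c + (k + 1) : ℕ) : ZMod n) ^ (m - k)

lemma weight_succ {n m : ℕ} (hm : n = m + 2) (a : ZMod n → K) (ha : ∀ j, a j ≠ 0) (c : ℕ) :
    weight a m (c + 1) * a ((c + 1 : ℕ) : ZMod n) ^ (m + 1) * a c
      = weight a m c * ∏ k ∈ range n, a k := by
  have h1 := prod_pow_shift (fun k => a ((c + 1 + k : ℕ) : ZMod n)) m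
  have h2 : ∏ k ∈ range n, a ((c + k : ℕ) : ZMod n)
      = (∏ k ∈ range m, a ((c + 1 + (k + 1) : ℕ) : ZMod n))
        * a ((c + 1 : ℕ) : ZMod n) * a c := by
    rw [show range n = range (m + 1 + 1) by rw [hm], prod_range_succ', prod_range_succ']
    simp only [add_zero, zero_add]
    refine congrArg (· * _ * _) (prod_congr rfl fun k _ => congrArg (fun j : ℕ => a j) ?_)
    omega
  rw [← prod_period a ha c, h2]
  have h3 : weight a m c = ∏ k ∈ range m, a ((c + 1 + k : ℕ) : ZMod n) ^ (m - k) :=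
    prod_congr rfl fun k _ => by rw [add_assoc, add_comm 1 k]
  have h4 : weight a m (c + 1)
      = ∏ k ∈ range m, a ((c + 1 + (k + 1) : ℕ) : ZMod n) ^ (m - k) := rfl
  rw [← h3, ← h4] at h1
  simp only [add_zero] at h1
  linear_combination a ((c + 1 : ℕ) : ZMod n) * a c * h1

lemma weight_zero_mul {n m : ℕ} (hm : n = m + 2) (a : ZMod n → K) :
    weight a m 0 * (∏ k ∈ range (m + 1), a ((k + 1 : ℕ) : ZMod n) ^ (k + 1)) * a 0 ^ (m + 1)
      = (∏ k ∈ range n, a k) ^ (m + 1) := by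
  have h1 : weight a m 0 = ∏ k ∈ range (m + 1), a ((k + 1 : ℕ) : ZMod n) ^ (m - k) := by
    simp [weight, prod_range_succ]
  rw [h1, show range n = range (m + 1 + 1) by rw [hm], prod_range_succ' _ (m + 1), mul_pow,
    ← prod_pow, ← prod_mul_distrib, Nat.cast_zero]
  refine congrArg (· * _) (prod_congr rfl fun k hk => ?_)
  rw [← pow_add]
  congr 1
  have := mem_range.1 hk
  omega

lemma iterate_a (u : Tup N K) (k : ℕ) (j : ZMod (2 * N)) :
    (piMap^[k] u).a j = u.a (k + j) := by
  induction k generalizing j with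
  | zero => simp
  | succ k ih =>
    rw [Function.iterate_succ_apply']
    simp only [piMap, ih]
    congr 1
    push_cast
    ring

lemma iterate_q (u : Tup N K) (k : ℕ) : (piMap^[k] u).q = u.q := by
  induction k with
  | zero => rfl
  | succ k ih => rw [Function.iterate_succ_apply']; exact ih

lemma iterate_b (u : Tup N K) (k : ℕ) : (piMap^[k] u).b = u.q ^ k * u.b := by
  induction k with
  | zero => simp
  | succ k ih =>
    rw [Function.iterate_succ_apply']
    simp only [piMap, ih, iterate_q]
    ring

lemma iterate_f (u : Tup N K) (k j : ℕ) (hj : j < 2 * N) :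
    (piMap^[k] u).f (j + 1) = (piMap^[k + j] u).f 1 := by
  induction j generalizing k with
  | zero => rfl
  | succ j ih =>
    rw [show k + (j + 1) = k + 1 + j by ring, ← ih (k + 1) (by omega),
      Function.iterate_succ_apply']
    simp only [piMap]
    rw [if_pos (by omega)]

lemma prod_iterate_f (u : Tup N K) (k : ℕ) :
    ∏ j ∈ Icc 1 (2 * N), (piMap^[k] u).f j
      = ∏ j ∈ range (2 * N), (piMap^[k + j] u).f 1 := by
  rw [← Finset.Ico_add_one_right_eq_Icc, prod_Ico_eq_prod_range]
  refine prod_congr (by simp) fun j hj => ?_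
  rw [add_comm 1 j, iterate_f u k j (by simpa using hj)]

lemma weight_eq_prod_iterate {m : ℕ} (hm : 2 * N = m + 2) (u : Tup N K) (k : ℕ) :
    ∏ j ∈ Icc 1 (2 * N - 2), (piMap^[k] u).a j ^ (2 * N - j - 1) = weight u.a m k := by
  rw [← Finset.Ico_add_one_right_eq_Icc, prod_Ico_eq_prod_range]
  refine prod_congr (by simp [hm]) fun j hj => ?_
  rw [iterate_a, add_comm 1 j, ← Nat.cast_add]
  congr 1
  omega

lemma iterate_f_recurrence {m : ℕ} (hm : 2 * N = m + 2) (u : Tup N K) (k : ℕ)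
    (hk : Nz (piMap^[k] u)) :
    ((piMap^[k + 2 * N] u).f 1 + 1 / (piMap^[k] u).f 1)
        * (weight u.a m k * ∏ j ∈ range (2 * N), (piMap^[k + j] u).f 1)
      = -(u.q ^ (m + 1) * u.a k * (u.q ^ k * u.b)) := by
  have h1 : (piMap^[k + 2 * N] u).f 1 = Pval (piMap^[k] u) := by
    rw [show k + 2 * N = k + 1 + (m + 1) by omega, ← iterate_f u (k + 1) (m + 1) (by omega),
      Function.iterate_succ_apply']
    simp only [piMap]
    rw [if_neg (by omega), if_pos (by omega)]
  obtain ⟨ha, -, -, hf⟩ := hk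
  have h2 : weight u.a m k ≠ 0 := by
    rw [← weight_eq_prod_iterate hm]
    exact prod_ne_zero_iff.2 fun j _ => pow_ne_zero _ (ha j)
  have h3 : ∏ j ∈ range (2 * N), (piMap^[k + j] u).f 1 ≠ 0 := by
    rw [← prod_iterate_f]
    exact prod_ne_zero_iff.2 hf
  rw [h1, Pval, weight_eq_prod_iterate hm, prod_iterate_f, iterate_q, iterate_a, iterate_b,
    sub_add_cancel, div_mul_cancel₀ _ (mul_ne_zero h2 h3), add_zero,
    show 2 * N - 1 = m + 1 by omega]

lemma prod_shift (x : ℕ → K) (n k : ℕ) :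
    (∏ j ∈ range n, x (k + 1 + j)) * x k = (∏ j ∈ range n, x (k + j)) * x (k + n) := by
  have h := (prod_range_succ' (fun j => x (k + j)) n).symm.trans
    (prod_range_succ (fun j => x (k + j)) n)
  simp only [add_zero] at h
  rw [← h]
  exact congrArg (· * _) (prod_congr rfl fun j _ => congrArg x (by omega))

/-- In the `(1,…,1)`-periodic reduction with `n = 2N`, the time evolution of the higher
order `q`-Painlevé system is `T̂₀ = π⁻²ᴺ`: writing `π^{2N}(u) = (a₀,…,a_{2N−1}, q²ᴺ·b, q,
f₁,…,f_{2N})` and `u = (a₀,…,a_{2N−1}, b, q, g₁,…,g_{2N})`, the components satisfy the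
`2N`-th order system qP⁽²ᴺ⁾(A₆⁽¹⁾), generalizing the `q`-Painlevé II equation of
`A₆⁽¹⁾`-surface type. -/
theorem qP2N_A6_from_pi_pow (hN : 2 ≤ N) (u : Tup N K)
    (hC : (∏ k ∈ range (2 * N), u.a k) = u.q)
    (h : ∀ k ≤ 2 * N, Nz (piMap^[k] u)) :
    (∀ j : ZMod (2 * N), (piMap^[2 * N] u).a j = u.a j) ∧
    (piMap^[2 * N] u).b = u.q ^ (2 * N) * u.b ∧
    (piMap^[2 * N] u).q = u.q ∧
    (∀ i ∈ Icc 1 (2 * N - 1),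
      u.f i + 1 / (piMap^[2 * N] u).f i
        = (u.a i ^ (2 * N))⁻¹ * ((piMap^[2 * N] u).f (i + 1) + 1 / u.f (i + 1))) ∧
    u.f (2 * N) + 1 / (piMap^[2 * N] u).f (2 * N)
      = -(∏ k ∈ Icc 1 (2 * N - 1), u.a k ^ k) * (u.q ^ (2 * N) * u.b)
          / ∏ k ∈ Icc 1 (2 * N), (piMap^[2 * N] u).f k := by
  obtain ⟨m, hm⟩ : ∃ m, 2 * N = m + 2 := ⟨2 * N - 2, by omega⟩
  obtain ⟨ha, -, -, -⟩ : Nz u := h 0 (by omega)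
  have hx0 : ∀ k, k ≤ 2 * N → (piMap^[k] u).f 1 ≠ 0 := fun k hk =>
    (h k hk).2.2.2 1 (mem_Icc.2 (by omega))
  have hx1 : ∀ j, j < 2 * N → (piMap^[j + 2 * N] u).f 1 ≠ 0 := fun j hj => by
    rw [add_comm, ← iterate_f u _ j hj]
    exact (h _ le_rfl).2.2.2 _ (mem_Icc.2 (by omega))
  have hg : ∀ j, j < 2 * N → u.f (j + 1) = (piMap^[j] u).f 1 := fun j hj => by
    simpa using iterate_f u 0 j hj
  have hf : ∀ j, j < 2 * N → (piMap^[2 * N] u).f (j + 1) = (piMap^[j + 2 * N] u).f 1 :=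
    fun j hj => by rw [iterate_f u _ j hj, add_comm]
  have hrec := fun k hk => iterate_f_recurrence hm u k (h k hk)
  have hw := weight_succ hm u.a ha
  have hw0 := weight_zero_mul hm u.a
  rw [hC] at hw0
  simp only [hC] at hw
  have hwne : ∀ k, weight u.a m k ≠ 0 := fun k =>
    prod_ne_zero_iff.2 fun j _ => pow_ne_zero _ (ha _)
  have hP := prod_shift (fun k => (piMap^[k] u).f 1) (2 * N)
  have hPne : ∀ k, k ≤ 2 * N → ∏ j ∈ range (2 * N), (piMap^[k + j] u).f 1 ≠ 0 := fun k hk => by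
    rw [← prod_iterate_f]
    exact prod_ne_zero_iff.2 (h k hk).2.2.2
  have key : ∀ k, k < 2 * N →
      ((piMap^[k] u).f 1 + 1 / (piMap^[k + 2 * N] u).f 1)
          * (u.a ((k + 1 : ℕ) : ZMod (2 * N)) ^ (m + 1)
            * (weight u.a m (k + 1) * ∏ j ∈ range (2 * N), (piMap^[k + 1 + j] u).f 1))
        = -(u.q ^ (m + 1) * (u.q ^ (k + 1) * u.b)) := fun k hk => by
    have h1 := hrec k hk.le
    have h2 := hw k
    have h3 := hP k
    have hx := hx0 k hk.le
    have hy := hx1 k hk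
    have hak := ha k
    generalize ∏ j ∈ range (2 * N), (piMap^[k + j] u).f 1 = P at *
    generalize ∏ j ∈ range (2 * N), (piMap^[k + 1 + j] u).f 1 = P' at *
    generalize (piMap^[k] u).f 1 = x at *
    generalize (piMap^[k + 2 * N] u).f 1 = y at *
    have h4 : (x + 1 / y) * P' = (y + 1 / x) * P := by
      field_simp
      linear_combination (x * y + 1) * h3
    refine mul_right_cancel₀ hak ?_
    linear_combination ((x + 1 / y) * P') * h2 + weight u.a m k * u.q * h4 + u.q * h1
  refine ⟨fun j => ?_, iterate_b u _, iterate_q u _, fun i hi => ?_, ?_⟩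
  · rw [iterate_a, CharP.cast_eq_zero, zero_add]
  · obtain ⟨k, rfl⟩ : ∃ k, i = k + 1 := ⟨i - 1, by have := mem_Icc.1 hi; omega⟩
    have hk : k + 1 < 2 * N := by have := mem_Icc.1 hi; omega
    rw [hg k (by omega), hf k (by omega), hg _ hk, hf _ hk]
    have h1 := key k (by omega)
    have h2 := hrec (k + 1) hk.le
    have hak := ha ((k + 1 : ℕ) : ZMod (2 * N))
    rw [eq_inv_mul_iff_mul_eq₀ (pow_ne_zero _ hak), show u.a ((k + 1 : ℕ) : ZMod (2 * N)) ^ (2 * N)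
      = u.a ((k + 1 : ℕ) : ZMod (2 * N)) ^ (m + 2) from congrArg _ hm]
    refine mul_right_cancel₀ (mul_ne_zero (hwne (k + 1)) (hPne (k + 1) hk.le)) ?_
    linear_combination u.a ((k + 1 : ℕ) : ZMod (2 * N)) * h1 - h2
  · have h1 := key (m + 1) (by omega)
    have hw' : weight u.a m (m + 1 + 1) = weight u.a m 0 :=
      prod_congr rfl fun k _ => by
        rw [show m + 1 + 1 = 2 * N from hm.symm, Nat.cast_add, CharP.cast_eq_zero]
        simp
    have ha' : u.a ((m + 1 + 1 : ℕ) : ZMod (2 * N)) = u.a 0 := by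
      rw [show m + 1 + 1 = 2 * N from hm.symm, CharP.cast_eq_zero]
    have hA : ∏ k ∈ Icc 1 (2 * N - 1), u.a k ^ k
        = ∏ k ∈ range (m + 1), u.a ((k + 1 : ℕ) : ZMod (2 * N)) ^ (k + 1) := by
      rw [← Finset.Ico_add_one_right_eq_Icc, prod_Ico_eq_prod_range]
      refine prod_congr (by rw [hm]; simp) fun k _ => ?_
      rw [add_comm 1 k]
    have hgN : u.f (2 * N) = (piMap^[m + 1] u).f 1 := by
      rw [← hg (m + 1) (by omega), show 2 * N = m + 1 + 1 from hm]
    have hfN : (piMap^[2 * N] u).f (2 * N) = (piMap^[m + 1 + 2 * N] u).f 1 := by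
      rw [← hf (m + 1) (by omega), show m + 1 + 1 = 2 * N from hm.symm]
    rw [hw', ha', show m + 1 + 1 = 2 * N from hm.symm] at h1
    rw [hA, prod_iterate_f, hgN, hfN, eq_div_iff (hPne _ le_rfl)]
    refine mul_right_cancel₀ (mul_ne_zero (pow_ne_zero (m + 1) (ha 0)) (hwne 0)) ?_
    linear_combination h1 + u.q ^ (2 * N) * u.b * hw0

end QP2NA6
end
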